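/- arXiv:1208.3819 — 11 statements merged into one kernel-verified Lean document; each statement's English description precedes it below -/
import Mathlib

section
/- Let H be a (real) Hadamard matrix of order n, and let m, d be positive integers with m + d = n and 0 < d < n. Then for every m×m submatrix M of H there exists a d×d submatrix M' of H such that |det(M)| = n^{n/2 − d} · |det(M')|. (In fact M' may be taken to be the submatrix of Hᵀ on the complementary row and column index sets of M.) -/
/-- A `{±1}`-matrix: every entry is `+1` or `-1`. -/
def IsPM1 {n : ℕ} (A : Matrix (Fin n) (Fin n) ℝ) : Prop :=
  ∀ i j, A i j = 1 ∨ A i j = -1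

/-- A Hadamard matrix of order `n`. -/
def IsHadamardMatrix {n : ℕ} (H : Matrix (Fin n) (Fin n) ℝ) : Prop :=
  IsPM1 H ∧ H * H.transpose = (n : ℝ) • (1 : Matrix (Fin n) (Fin n) ℝ)

theorem exists_sum_equiv {n m d : ℕ} (hmd : m + d = n) (f : Fin m → Fin n)
    (hf : Function.Injective f) :
    ∃ e : Fin m ⊕ Fin d ≃ Fin n, ∀ i, e (Sum.inl i) = f i := by
  classical
  have h1 : Fintype.card (Set.range f) = m := by
    rw [Set.card_range_of_injective hf, Fintype.card_fin]
  have h2 : Fintype.card ((Set.range f)ᶜ : Set (Fin n)) = d := by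
    rw [Fintype.card_compl_set, h1, Fintype.card_fin]; omega
  let e2 : Fin d ≃ ((Set.range f)ᶜ : Set (Fin n)) := (Fintype.equivFinOfCardEq h2).symm
  refine ⟨(Equiv.sumCongr (Equiv.ofInjective f hf) e2).trans (Equiv.Set.sumCompl _), ?_⟩
  intro i
  simp

theorem szollosi_minor_correspondence {n m d : ℕ}
    (hm : 0 < m) (hd : 0 < d) (hmd : m + d = n) (hdn : d < n)
    (H : Matrix (Fin n) (Fin n) ℝ) (hH : IsHadamardMatrix H)
    (f g : Fin m → Fin n) (hf : Function.Injective f) (hg : Function.Injective g) :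
    ∃ f' g' : Fin d → Fin n, Function.Injective f' ∧ Function.Injective g' ∧
      |(H.submatrix f g).det| =
        (n : ℝ) ^ ((n : ℝ) / 2 - (d : ℝ)) * |(H.submatrix f' g').det| := by
  obtain ⟨e, he⟩ := exists_sum_equiv hmd f hf
  obtain ⟨k, hk⟩ := exists_sum_equiv hmd g hg
  refine ⟨fun i => e (Sum.inr i), fun i => k (Sum.inr i),
    e.injective.comp Sum.inr_injective, k.injective.comp Sum.inr_injective, ?_⟩
  have hn : (0 : ℝ) < n := by
    have : 0 < n := by omega
    exact_mod_cast this
  set D := H.submatrix (fun i => e (Sum.inr i)) (fun i => k (Sum.inr i)) with hD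
  set A := H.submatrix f g with hA
  set B := H.submatrix f (fun i => k (Sum.inr i)) with hB
  set C := H.submatrix (fun i => e (Sum.inr i)) g with hC
  have hK : H.submatrix e k = Matrix.fromBlocks A B C D := by
    ext i j
    rcases i with i | i <;> rcases j with j | j <;> simp [A, B, C, D, he, hk]
  have hKK : H.submatrix e k * (H.submatrix e k).transpose = (n : ℝ) • 1 := by
    rw [Matrix.transpose_submatrix, Matrix.submatrix_mul_equiv, hH.2, Matrix.submatrix_smul]
    simp
  have hdet : |(H.submatrix e k).det| = (n : ℝ) ^ ((n : ℝ) / 2) := by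
    have h := congrArg Matrix.det hKK
    rw [Matrix.det_mul, Matrix.det_transpose, Matrix.det_smul, Matrix.det_one, mul_one,
      Fintype.card_sum, Fintype.card_fin, Fintype.card_fin, hmd] at h
    have h3 : ((n : ℝ) ^ ((n : ℝ) / 2)) ^ 2 = (n : ℝ) ^ n := by
      rw [← Real.rpow_natCast, ← Real.rpow_mul hn.le, ← Real.rpow_natCast]
      congr 1
      push_cast
      ring
    rw [← abs_of_nonneg (Real.rpow_nonneg hn.le ((n : ℝ) / 2)), ← sq_eq_sq_iff_abs_eq_abs, h3,
      ← h, sq]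
  rw [hK, Matrix.fromBlocks_transpose, Matrix.fromBlocks_multiply, ← Matrix.fromBlocks_one,
    Matrix.fromBlocks_smul, Matrix.fromBlocks_inj] at hKK
  obtain ⟨-, h12, -, h22⟩ := hKK
  have hprod : H.submatrix e k * Matrix.fromBlocks 1 C.transpose 0 D.transpose
      = Matrix.fromBlocks A 0 C ((n : ℝ) • 1) := by
    rw [hK, Matrix.fromBlocks_multiply, h12, h22]
    simp
  have h := congrArg (fun M => |Matrix.det M|) hprod
  simp only [Matrix.det_mul, Matrix.det_fromBlocks_zero₂₁, Matrix.det_fromBlocks_zero₁₂,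
    Matrix.det_one, Matrix.det_transpose, Matrix.det_smul, one_mul, mul_one, abs_mul, hdet,
    Fintype.card_fin, abs_pow, abs_of_pos hn] at h
  rw [Real.rpow_sub hn, Real.rpow_natCast, div_mul_eq_mul_div, h]
  field_simp
end

section
/- Let H be an invertible n×n real matrix, let R, C be m-element subsets of the row and column indices (0 < m < n), and let M be the m×m submatrix of H on rows R and columns C. Let M'' be the (n−m)×(n−m) submatrix of H⁻¹ on rows indexed by the complement of C and columns indexed by the complement of R. Then |det(M'')| = |det(M)| / |det(H)|. -/
theorem jacobi_aux {k l : ℕ} (A B : Matrix (Fin k ⊕ Fin l) (Fin k ⊕ Fin l) ℝ) (h : A * B = 1) :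
    A.det * B.toBlocks₂₂.det = A.toBlocks₁₁.det := by
  have e : A * Matrix.fromBlocks 1 B.toBlocks₁₂ 0 B.toBlocks₂₂ =
      Matrix.fromBlocks A.toBlocks₁₁ 0 A.toBlocks₂₁ 1 := by
    have h' := h
    rw [← Matrix.fromBlocks_toBlocks A, ← Matrix.fromBlocks_toBlocks B,
      Matrix.fromBlocks_multiply, ← Matrix.fromBlocks_one, Matrix.fromBlocks_inj] at h'
    obtain ⟨-, h2, -, h4⟩ := h'
    conv_lhs => rw [← Matrix.fromBlocks_toBlocks A]
    rw [Matrix.fromBlocks_multiply, h2, h4]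
    simp
  have := congrArg Matrix.det e
  simpa [Matrix.det_mul, Matrix.det_fromBlocks_zero₂₁, Matrix.det_fromBlocks_zero₁₂] using this

/-- Absolute-value form of Jacobi's complementary-minor determinant identity. -/
theorem jacobi_complementary_minor_abs {n m : ℕ} (hm : 0 < m) (hmn : m < n)
    (H : Matrix (Fin n) (Fin n) ℝ) (hH : IsUnit H.det)
    (R C : Finset (Fin n)) (hR : R.card = m) (hC : C.card = m) :
    |((H⁻¹).submatrix
        (fun i : Fin (n - m) =>
          (Cᶜ.orderIsoOfFin (by simp [Finset.card_compl, hC]) i : Fin n))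
        (fun j : Fin (n - m) =>
          (Rᶜ.orderIsoOfFin (by simp [Finset.card_compl, hR]) j : Fin n))).det| =
      |(H.submatrix (fun i => (R.orderIsoOfFin hR i : Fin n))
        (fun j => (C.orderIsoOfFin hC j : Fin n))).det| / |H.det| := by
  have hR' : Rᶜ.card = n - m := by simp [Finset.card_compl, hR]
  have hC' : Cᶜ.card = n - m := by simp [Finset.card_compl, hC]
  have h1 : H.submatrix (finSumEquivOfFinset hR hR') (finSumEquivOfFinset hC hC') *
      (H⁻¹).submatrix (finSumEquivOfFinset hC hC') (finSumEquivOfFinset hR hR') = 1 := by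
    rw [Matrix.submatrix_mul_equiv, Matrix.mul_nonsing_inv _ hH, Matrix.submatrix_one_equiv]
  have h2 := congrArg abs (jacobi_aux _ _ h1)
  rw [abs_mul, Matrix.abs_det_submatrix_equiv_equiv] at h2
  rw [eq_div_iff (abs_ne_zero.mpr hH.ne_zero), mul_comm]
  have e1 : (H⁻¹.submatrix (finSumEquivOfFinset hC hC') (finSumEquivOfFinset hR hR')).toBlocks₂₂ =
      H⁻¹.submatrix (fun i => (Cᶜ.orderIsoOfFin hC' i : Fin n))
        (fun j => (Rᶜ.orderIsoOfFin hR' j : Fin n)) := by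
    ext i j
    simp [Matrix.toBlocks₂₂]
  have e2 : (H.submatrix (finSumEquivOfFinset hR hR') (finSumEquivOfFinset hC hC')).toBlocks₁₁ =
      H.submatrix (fun i => (R.orderIsoOfFin hR i : Fin n))
        (fun j => (C.orderIsoOfFin hC j : Fin n)) := by
    ext i j
    simp [Matrix.toBlocks₁₁]
  rw [e1, e2] at h2
  exact h2
end

section
/- Suppose a Hadamard matrix H of order n has an m×m submatrix M, where n/2 ≤ m ≤ n. Then |det(M)| ≤ n^{m − n/2} · D(n − m), where for m = n the factor D(0) is interpreted as 1. -/
/-- `maxDet k` is the maximal determinant `D(k)`: the maximum of `|det A|` over all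
`{±1}`-matrices `A` of order `k`.  (Note `maxDet 0 = 1`.) -/
noncomputable def maxDet (k : ℕ) : ℝ :=
  sSup {x : ℝ | ∃ A : Matrix (Fin k) (Fin k) ℝ, IsPM1 A ∧ x = |A.det|}

theorem exists_ext_equiv {n m : ℕ} (hmn : m ≤ n) (f : Fin m → Fin n)
    (hf : Function.Injective f) :
    ∃ e : Fin m ⊕ Fin (n - m) ≃ Fin n, ∀ i, e (Sum.inl i) = f i := by
  classical
  have hc : Fintype.card ((Set.range f)ᶜ : Set (Fin n)) = n - m := by
    rw [Fintype.card_compl_set, Set.card_range_of_injective hf]; simp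
  let e2 : Fin (n - m) ≃ ((Set.range f)ᶜ : Set (Fin n)) :=
    (Fintype.equivFinOfCardEq hc).symm
  refine ⟨(Equiv.sumCongr (Equiv.ofInjective f hf) e2).trans
    (Equiv.Set.sumCompl (Set.range f)), fun i => ?_⟩
  simp

theorem abs_det_le_maxDet {k : ℕ} (A : Matrix (Fin k) (Fin k) ℝ) (hA : IsPM1 A) :
    |A.det| ≤ maxDet k := by
  apply le_csSup
  · refine ⟨(Fintype.card (Fin k)).factorial • (1:ℝ) ^ Fintype.card (Fin k), ?_⟩
    rintro x ⟨B, hB, rfl⟩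
    refine Matrix.det_le (abv := AbsoluteValue.abs) (A := B) (x := 1) fun i j => ?_
    rcases hB i j with h | h <;> simp [h]
  · exact ⟨A, hA, rfl⟩

theorem abs_det_submatrix_le {n m : ℕ}
    (H : Matrix (Fin n) (Fin n) ℝ) (hH : IsHadamardMatrix H)
    (hmn : m ≤ n) (hnm : n ≤ 2 * m)
    (f g : Fin m → Fin n) (hf : Function.Injective f) (hg : Function.Injective g) :
    |(H.submatrix f g).det| ≤
      (n : ℝ) ^ ((m : ℝ) - (n : ℝ) / 2) * maxDet (n - m) := by
  obtain ⟨e, he⟩ := exists_ext_equiv hmn f hf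
  obtain ⟨e', he'⟩ := exists_ext_equiv hmn g hg
  obtain ⟨hpm, hHH⟩ := hH
  rcases Nat.eq_zero_or_pos n with hn | hn
  · subst hn
    obtain rfl : m = 0 := by omega
    have := abs_det_le_maxDet (1 : Matrix (Fin 0) (Fin 0) ℝ) (fun i => i.elim0)
    simpa using this
  have hnR : (0:ℝ) < n := by exact_mod_cast hn
  set K := H.submatrix e e' with hK
  have hKK : K * K.transpose = (n : ℝ) • 1 := by
    rw [hK, Matrix.transpose_submatrix, Matrix.submatrix_mul_equiv, hHH]
    ext i j
    simp [Matrix.one_apply]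
  have hA : K.toBlocks₁₁ = H.submatrix f g := by
    ext i j; simp [hK, Matrix.toBlocks₁₁, he, he']
  have hD : |K.toBlocks₂₂.det| ≤ maxDet (n - m) :=
    abs_det_le_maxDet _ fun i j => hpm _ _
  rw [← hA]
  have hdet2 : |K.det| ^ 2 = (n:ℝ) ^ n := by
    have := congrArg Matrix.det hKK
    rw [Matrix.det_mul, Matrix.det_transpose, Matrix.det_smul, Matrix.det_one] at this
    rw [sq_abs, sq, this]
    simp [Nat.add_sub_cancel' hmn]
  have hdet : |K.det| = (n:ℝ) ^ ((n:ℝ) / 2) := by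
    rw [← Real.sqrt_sq (abs_nonneg K.det), hdet2, Real.sqrt_eq_rpow, ← Real.rpow_natCast,
      ← Real.rpow_mul hnR.le]
    ring_nf
  clear_value K
  rw [← Matrix.fromBlocks_toBlocks K] at hKK hdet
  generalize K.toBlocks₂₂ = D at *
  generalize K.toBlocks₁₁ = A at *
  generalize K.toBlocks₁₂ = B at *
  generalize K.toBlocks₂₁ = C at *
  rw [Matrix.fromBlocks_transpose, Matrix.fromBlocks_multiply, ← Matrix.fromBlocks_one,
    Matrix.fromBlocks_smul, Matrix.fromBlocks_inj] at hKK
  obtain ⟨-, h12, -, h22⟩ := hKK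
  have hmul : Matrix.fromBlocks A B C D * Matrix.fromBlocks 1 C.transpose 0 D.transpose
      = Matrix.fromBlocks A 0 C ((n:ℝ) • 1) := by
    rw [Matrix.fromBlocks_multiply, h12, h22]
    simp
  have h := congrArg (fun M => |Matrix.det M|) hmul
  simp only [Matrix.det_mul, Matrix.det_fromBlocks_zero₂₁, Matrix.det_fromBlocks_zero₁₂,
    Matrix.det_smul, Matrix.det_one, Matrix.det_transpose, abs_mul, hdet, one_mul, mul_one,
    Fintype.card_fin, abs_one, abs_pow, Nat.abs_cast] at h
  have key : |A.det| = (n:ℝ) ^ ((m:ℝ) - (n:ℝ) / 2) * |D.det| := by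
    have hp : (0:ℝ) < (n:ℝ) ^ (n - m) := by positivity
    apply mul_right_cancel₀ hp.ne'
    rw [← h, mul_right_comm, ← Real.rpow_natCast, ← Real.rpow_add hnR, Nat.cast_sub hmn]
    ring_nf
  rw [key]
  exact mul_le_mul_of_nonneg_left hD (by positivity)
end

section
/- (Cohn) Let H be a Hadamard matrix of order n having a Hadamard submatrix M of order m with m < n (that is, some m×m submatrix of H is itself a Hadamard matrix). Then m ≤ n/2. -/
/-- (Cohn) A Hadamard matrix of order `n` has no proper Hadamard submatrix of
order `m > n/2`. -/
theorem cohn_no_large_hadamard_submatrix {n m : ℕ}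
    (H : Matrix (Fin n) (Fin n) ℝ) (hH : IsHadamardMatrix H)
    (f g : Fin m → Fin n) (hf : Function.Injective f) (hg : Function.Injective g)
    (hM : IsHadamardMatrix (H.submatrix f g)) (hmn : m < n) :
    2 * m ≤ n := by
  classical
  obtain ⟨-, hH⟩ := hH
  obtain ⟨-, hM⟩ := hM
  let B : Matrix (Fin m) {j : Fin n // ¬ (j ∈ Set.range g)} ℝ := fun i j => H (f i) j.1
  have hB : B * B.transpose = ((n : ℝ) - m) • (1 : Matrix (Fin m) (Fin m) ℝ) := by
    ext i k
    have h1 := congrFun (congrFun hH (f i)) (f k)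
    have h2 := congrFun (congrFun hM i) k
    simp only [Matrix.mul_apply, Matrix.transpose_apply, Matrix.smul_apply, Matrix.one_apply,
      Matrix.submatrix_apply, hf.eq_iff, smul_eq_mul] at h1 h2 ⊢
    have h0 : ∑ j : {j : Fin n // j ∈ Set.range g}, H (f i) j.1 * H (f k) j.1
        + ∑ j : {j : Fin n // ¬ (j ∈ Set.range g)}, H (f i) j.1 * H (f k) j.1
        = ∑ j, H (f i) j * H (f k) j := by
      convert Fintype.sum_subtype_add_sum_subtype (fun j => j ∈ Set.range g)
        (fun j => H (f i) j * H (f k) j)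
    have h3 : ∑ j : {j : Fin n // j ∈ Set.range g}, H (f i) j.1 * H (f k) j.1
        = ∑ j, H (f i) (g j) * H (f k) (g j) :=
      (Fintype.sum_equiv (Equiv.ofInjective g hg) _ _ (fun j => rfl)).symm
    simp only [B]
    rw [h3, h2, h1] at h0
    linarith
  have hne : (n : ℝ) - m ≠ 0 := by
    have : (m : ℝ) < n := by exact_mod_cast hmn
    linarith
  have hr : (B * B.transpose).rank = m := by
    rw [hB, Matrix.rank_of_isUnit, Fintype.card_fin]
    rw [Matrix.isUnit_iff_isUnit_det, Matrix.det_smul, Matrix.det_one, mul_one]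
    exact (pow_ne_zero _ hne).isUnit
  have hle := (Matrix.rank_mul_le_left B B.transpose).trans (Matrix.rank_le_card_width B)
  rw [hr, Fintype.card_subtype_compl] at hle
  have hc : Fintype.card {j : Fin n // j ∈ Set.range g} = m := by
    rw [← Fintype.card_congr (Equiv.ofInjective g hg), Fintype.card_fin]
  rw [hc, Fintype.card_fin] at hle
  omega
end

section
/- Assume the Hadamard conjecture: for every positive integer k there exists a Hadamard matrix of order 4k. Let H be a Hadamard matrix of order n having a maxdet submatrix M of order m with m < n (that is, some m×m submatrix M of H satisfies |det(M)| = D(m)). Then m < n/2 + 5·ln(n) or m ≥ n − 2. -/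
lemma hadamard_ineq {d : ℕ} (A : Matrix (Fin d) (Fin d) ℝ) (hA : IsPM1 A) :
    A.det ^ 2 ≤ (d : ℝ) ^ d := by
  rcases Nat.eq_zero_or_pos d with rfl | hd
  · simp
  have hS : (A * A.conjTranspose).PosSemidef := Matrix.posSemidef_self_mul_conjTranspose A
  have hdet := hS.1.det_eq_prod_eigenvalues
  have htr := hS.1.trace_eq_sum_eigenvalues
  have hnn := hS.eigenvalues_nonneg
  have h1 : (A * A.conjTranspose).det = A.det ^ 2 := by
    simp [Matrix.det_mul, Matrix.conjTranspose_eq_transpose_of_trivial, Matrix.det_transpose, sq]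
  have h2 : (A * A.conjTranspose).trace = (d : ℝ) * d := by
    have : ∀ i j, A i j * A i j = 1 := fun i j => by
      rcases hA i j with h | h <;> simp [h]
    simp [Matrix.trace, Matrix.mul_apply, Matrix.conjTranspose_eq_transpose_of_trivial, this]
  rw [h1] at hdet
  rw [h2] at htr
  simp only [RCLike.ofReal_real_eq_id, id] at hdet htr
  rw [hdet]
  have hd' : (0 : ℝ) < d := by exact_mod_cast hd
  have hb : ∀ i ∈ Finset.univ, hS.1.eigenvalues i ≤ d * Real.exp (hS.1.eigenvalues i / d - 1) := by
    intro i _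
    have h := Real.add_one_le_exp (hS.1.eigenvalues i / d - 1)
    have h' := mul_le_mul_of_nonneg_left h hd'.le
    have h3 : (d : ℝ) * (hS.1.eigenvalues i / d - 1 + 1) = hS.1.eigenvalues i := by
      field_simp; ring
    linarith
  refine (Finset.prod_le_prod (fun i _ => hnn i) hb).trans ?_
  rw [Finset.prod_mul_distrib, ← Real.exp_sum, Finset.sum_sub_distrib, ← Finset.sum_div, ← htr]
  have : (d : ℝ) * d / d - ∑ _x : Fin d, (1 : ℝ) = 0 := by simp
  rw [this]; simp

lemma le_maxDet {k : ℕ} (A : Matrix (Fin k) (Fin k) ℝ) (hA : IsPM1 A) :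
    A.det ^ 2 ≤ maxDet k ^ 2 := by
  have : |A.det| ≤ maxDet k := by
    apply le_csSup
    · refine ⟨Real.sqrt ((k : ℝ) ^ k), ?_⟩
      rintro x ⟨B, hB, rfl⟩
      exact Real.abs_le_sqrt (hadamard_ineq B hB)
    · exact ⟨A, hA, rfl⟩
  rw [← sq_abs]
  exact pow_le_pow_left₀ (abs_nonneg _) this 2

lemma extend_equiv {m d n : ℕ} (h : m + d = n) (f : Fin m → Fin n)
    (hf : Function.Injective f) : ∃ e : Fin m ⊕ Fin d ≃ Fin n, ∀ i, e (Sum.inl i) = f i := by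
  classical
  have hc : Fintype.card {x // ¬ x ∈ Set.range f} = d := by
    rw [Fintype.card_subtype_compl]
    have : Fintype.card {x // x ∈ Set.range f} = m := by
      have h := Fintype.card_congr (Equiv.ofInjective f hf)
      rw [Fintype.card_fin] at h
      refine Eq.trans ?_ h.symm
      exact Fintype.card_congr (Equiv.refl _)
    rw [this]; simp; omega
  refine ⟨(Equiv.sumCongr (Equiv.ofInjective f hf) (Fintype.equivFinOfCardEq hc).symm).trans
    (Equiv.sumCompl (fun x => x ∈ Set.range f)), fun i => ?_⟩
  simp

lemma had_det_sq {n : ℕ} {H : Matrix (Fin n) (Fin n) ℝ} (hH : IsHadamardMatrix H) :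
    H.det ^ 2 = (n : ℝ) ^ n := by
  have := congrArg Matrix.det hH.2
  simpa [Matrix.det_mul, Matrix.det_transpose, ← sq, Matrix.det_smul] using this

lemma jacobi {m d n : ℕ} (hn : 0 < n) (hmd : m + d = n) {H : Matrix (Fin n) (Fin n) ℝ}
    (hH : IsHadamardMatrix H) (e1 e2 : Fin m ⊕ Fin d ≃ Fin n) :
    (H.submatrix (fun i => e1 (Sum.inl i)) (fun i => e2 (Sum.inl i))).det ^ 2 * (n : ℝ) ^ d
      = n ^ m * (H.submatrix (fun i => e1 (Sum.inr i)) (fun i => e2 (Sum.inr i))).det ^ 2 := by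
  set A := H.submatrix (fun i => e1 (Sum.inl i)) (fun i => e2 (Sum.inl i)) with hA
  set B := H.submatrix (fun i => e1 (Sum.inl i)) (fun i => e2 (Sum.inr i)) with hB
  set C := H.submatrix (fun i => e1 (Sum.inr i)) (fun i => e2 (Sum.inl i)) with hC
  set D := H.submatrix (fun i => e1 (Sum.inr i)) (fun i => e2 (Sum.inr i)) with hD
  have hblk : H.submatrix e1 e2 = Matrix.fromBlocks A B C D := by
    ext (i | i) (j | j) <;> rfl
  have hdet : (H.submatrix e1 e2).det ^ 2 = (n : ℝ) ^ n := by
    have h3 : (H.submatrix e1 e2) * (H.submatrix e1 e2).transpose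
        = (n : ℝ) • (1 : Matrix (Fin m ⊕ Fin d) (Fin m ⊕ Fin d) ℝ) := by
      rw [Matrix.transpose_submatrix, Matrix.submatrix_mul_equiv, hH.2]
      ext i j; simp [Matrix.one_apply]
    have := congrArg Matrix.det h3
    rw [Matrix.det_mul, Matrix.det_transpose, ← sq, Matrix.det_smul, Fintype.card_sum,
      Fintype.card_fin, Fintype.card_fin, hmd, Matrix.det_one, mul_one] at this
    exact this
  have h3 : (H.submatrix e1 e2) * (H.submatrix e1 e2).transpose
        = (n : ℝ) • (1 : Matrix (Fin m ⊕ Fin d) (Fin m ⊕ Fin d) ℝ) := by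
    rw [Matrix.transpose_submatrix, Matrix.submatrix_mul_equiv, hH.2]
    ext i j; simp [Matrix.one_apply]
  rw [hblk, Matrix.fromBlocks_transpose, Matrix.fromBlocks_multiply, ← Matrix.fromBlocks_one,
    Matrix.fromBlocks_smul, Matrix.fromBlocks_inj] at h3
  obtain ⟨-, h12, -, h22⟩ := h3
  have key : Matrix.fromBlocks A B C D * Matrix.fromBlocks 1 C.transpose 0 D.transpose
      = Matrix.fromBlocks A 0 C ((n : ℝ) • 1) := by
    rw [Matrix.fromBlocks_multiply]
    simp [h12, h22]
  have k2 := congrArg (fun X => (Matrix.det X) ^ 2) key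
  simp only [Matrix.det_mul, Matrix.det_fromBlocks_zero₂₁, Matrix.det_fromBlocks_zero₁₂,
    Matrix.det_transpose, Matrix.det_one, one_mul, Matrix.det_smul, Fintype.card_fin, mul_one,
    mul_pow, ← hblk, hdet] at k2
  have hn' : (n : ℝ) ^ d ≠ 0 := by positivity
  apply mul_right_cancel₀ hn'
  rw [show (n:ℝ)^n = n^m * n^d by rw [← pow_add, hmd]] at k2
  linarith

lemma double_bound {k : ℕ} (A : Matrix (Fin (k+1)) (Fin (k+1)) ℝ) (hA : IsPM1 A) :
    4 * A.det ^ 2 ≤ maxDet (k + 1 + 1) ^ 2 := by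
  let R : Matrix (Fin 1) (Fin (k+1)) ℝ := fun _ j => if j = 0 then 1 else 0
  let U : Matrix (Fin (k+1)) (Fin 1) ℝ := fun _ _ => 1
  let W : Matrix (Fin 1) (Fin 1) ℝ := fun _ _ => -2
  let M := Matrix.fromBlocks 1 0 R 1 * Matrix.fromBlocks A U 0 W
  have hdet : M.det = A.det * (-2) := by
    simp only [M, Matrix.det_mul, Matrix.det_fromBlocks_zero₂₁, Matrix.det_fromBlocks_zero₁₂,
      Matrix.det_one, one_mul]
    rw [Matrix.det_fin_one]
  have hM : ∀ i j, M i j = 1 ∨ M i j = -1 := by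
    intro i j
    simp only [M, Matrix.fromBlocks_multiply]
    rcases i with i | i <;> rcases j with j | j
    · simpa using hA i j
    · left
      have : U i j = 1 := rfl
      simp [this]
    · have : (R * A) i j = A 0 j := by
        rw [Matrix.mul_apply]
        simp [R]
      simpa [this] using hA 0 j
    · right
      have h1 : (R * U) i j = 1 := by
        rw [Matrix.mul_apply]
        simp [R, U]
      have h2 : W i j = -2 := rfl
      simp [h1, h2]
      norm_num
  have h := le_maxDet (M.submatrix finSumFinEquiv.symm finSumFinEquiv.symm) (fun i j => hM _ _)
  rw [Matrix.det_submatrix_equiv_self, hdet] at h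
  linarith

lemma one_bound {m n : ℕ} (hmn : m + 1 = n) {H : Matrix (Fin n) (Fin n) ℝ}
    (hH : IsHadamardMatrix H) : (n : ℝ) ^ m ≤ maxDet m ^ 2 * n := by
  subst hmn
  have h := jacobi (m := m) (d := 1) (Nat.succ_pos m) rfl hH finSumFinEquiv finSumFinEquiv
  have hb := le_maxDet (H.submatrix (fun i => finSumFinEquiv (Sum.inl i))
    (fun i => finSumFinEquiv (Sum.inl i))) (fun i j => hH.1 _ _)
  have h1 : (H.submatrix (fun i : Fin 1 => finSumFinEquiv (Sum.inr i : Fin m ⊕ Fin 1))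
      (fun i => finSumFinEquiv (Sum.inr i))).det ^ 2 = 1 := by
    rw [Matrix.det_fin_one]
    simp only [Matrix.submatrix_apply]
    rcases hH.1 (finSumFinEquiv (Sum.inr 0 : Fin m ⊕ Fin 1))
      (finSumFinEquiv (Sum.inr 0 : Fin m ⊕ Fin 1)) with h | h <;> rw [h] <;> norm_num
  rw [h1, mul_one, pow_one] at h
  rw [← h]
  exact mul_le_mul_of_nonneg_right hb (by positivity)

lemma two_bound {m n : ℕ} (hmn : m + 2 = n) {H : Matrix (Fin n) (Fin n) ℝ}
    (hH : IsHadamardMatrix H) : 4 * (n : ℝ) ^ m ≤ maxDet m ^ 2 * n ^ 2 := by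
  have hn : 0 < n := by omega
  let a : Fin n := ⟨0, by omega⟩
  let b : Fin n := ⟨1, by omega⟩
  have hab : a ≠ b := by simp [a, b]
  have horth : ∑ j, H a j * H b j = 0 := by
    have := congrFun (congrFun hH.2 a) b
    simpa [Matrix.mul_apply, hab] using this
  have hex : ∃ j, H a j * H b j ≠ H a a * H b a := by
    by_contra! hcon
    rw [Finset.sum_congr rfl (fun j _ => hcon j)] at horth
    rcases hH.1 a a with h | h <;> rcases hH.1 b a with h' | h' <;>
      simp [h, h'] at horth <;> omega
  obtain ⟨c, hc⟩ := hex
  have hac : a ≠ c := by rintro h; rw [← h] at hc; exact hc rfl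
  obtain ⟨e1, he1⟩ := extend_equiv (m := 2) (d := m) (n := n) (by omega) ![a, b] (by
    intro i j; fin_cases i <;> fin_cases j <;> simp [hab, hab.symm])
  obtain ⟨e2, he2⟩ := extend_equiv (m := 2) (d := m) (n := n) (by omega) ![a, c] (by
    intro i j; fin_cases i <;> fin_cases j <;> simp [hac, hac.symm])
  have h := jacobi hn (by omega) hH ((Equiv.sumComm _ _).trans e1) ((Equiv.sumComm _ _).trans e2)
    (m := m) (d := 2)
  have hb := le_maxDet (H.submatrix (fun i => ((Equiv.sumComm _ _).trans e1) (Sum.inl i))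
    (fun i => ((Equiv.sumComm _ _).trans e2) (Sum.inl i))) (fun i j => hH.1 _ _)
  have h1 : (H.submatrix (fun i : Fin 2 => ((Equiv.sumComm (Fin m) (Fin 2)).trans e1) (Sum.inr i))
      (fun i => ((Equiv.sumComm _ _).trans e2) (Sum.inr i))).det ^ 2 = 4 := by
    rw [Matrix.det_fin_two]
    simp only [Matrix.submatrix_apply, Equiv.trans_apply, Equiv.sumComm_apply, Sum.swap_inr,
      he1, he2, Matrix.cons_val_zero, Matrix.cons_val_one]
    rcases hH.1 a a with k1 | k1 <;> rcases hH.1 b a with k2 | k2 <;>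
    rcases hH.1 a c with k3 | k3 <;> rcases hH.1 b c with k4 | k4 <;>
      simp only [k1, k2, k3, k4] at hc ⊢ <;> revert hc <;> norm_num
  rw [h1] at h
  rw [mul_comm, ← h]
  exact mul_le_mul_of_nonneg_right hb (by positivity)

lemma lower_bound (hc : ∀ k : ℕ, 0 < k →
      ∃ H : Matrix (Fin (4 * k)) (Fin (4 * k)) ℝ, IsHadamardMatrix H) (m : ℕ) (hm : 38 ≤ m) :
    15 * (m : ℝ) ^ m ≤ maxDet m ^ 2 * (m : ℝ) ^ 2 := by
  have hmR : (38 : ℝ) ≤ m := by exact_mod_cast hm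
  have hr : m % 4 = 0 ∨ m % 4 = 1 ∨ m % 4 = 2 ∨ m % 4 = 3 := by omega
  rcases hr with hr | hr | hr | hr
  · obtain ⟨q, rfl⟩ : ∃ q, m = 4 * q := ⟨m / 4, by omega⟩
    obtain ⟨H, hH⟩ := hc q (by omega)
    have h := le_maxDet H hH.1
    rw [had_det_sq hH] at h
    set x : ℝ := ((4 * q : ℕ) : ℝ)
    have hp : 0 ≤ x ^ (4 * q) := by positivity
    calc 15 * x ^ (4*q) ≤ x ^ 2 * x ^ (4 * q) := mul_le_mul_of_nonneg_right (by nlinarith) hp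
      _ ≤ _ := by rw [mul_comm]; exact mul_le_mul_of_nonneg_right h (by positivity)
  · obtain ⟨q, hq⟩ : ∃ q, m = 4 * q + 1 := ⟨m / 4, by omega⟩
    obtain ⟨H, hH⟩ := hc q (by omega)
    obtain ⟨k, hk⟩ : ∃ k, 4 * q = k + 1 := ⟨4 * q - 1, by omega⟩
    obtain rfl : m = k + 1 + 1 := by omega
    clear hq
    generalize 4 * q = h4 at H hH hk
    subst hk
    have h := double_bound H hH.1
    rw [had_det_sq hH] at h
    set x : ℝ := ((k + 1 : ℕ) : ℝ) with hx
    have hx1 : ((k + 1 + 1 : ℕ) : ℝ) = x + 1 := by simp [hx]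
    rw [hx1] at hmR ⊢
    have hx0 : 0 < x := by linarith
    have hexp : (x + 1) ^ (k + 1) ≤ 3 * x ^ (k + 1) := by
      have h1 : (1 + 1 / x) ^ (k + 1) ≤ 3 := by
        have h2 : 1 + 1 / x ≤ Real.exp (1 / x) := by linarith [Real.add_one_le_exp (1 / x)]
        have h3 : (1 + 1 / x) ^ (k + 1) ≤ Real.exp (1 / x) ^ (k + 1) := by gcongr
        rw [← Real.exp_nat_mul, ← hx, mul_one_div_cancel hx0.ne'] at h3
        linarith [Real.exp_one_lt_d9]
      have : x + 1 = (1 + 1 / x) * x := by field_simp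
      rw [this, mul_pow]
      gcongr
    have hp : 0 ≤ x ^ (k + 1) := by positivity
    calc 15 * (x + 1) ^ (k + 1 + 1) = (x + 1) ^ (k + 1) * (15 * (x + 1)) := by ring
      _ ≤ (3 * x ^ (k + 1)) * (15 * (x + 1)) := by gcongr
      _ ≤ (4 * x ^ (k + 1)) * (x + 1) ^ 2 := by
        have : 45 * (x + 1) ≤ 4 * (x + 1) ^ 2 := by nlinarith
        nlinarith
      _ ≤ _ := by gcongr
  · obtain ⟨q, hq⟩ : ∃ q, m + 2 = 4 * q := ⟨m / 4 + 1, by omega⟩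
    obtain ⟨H, hH⟩ := hc q (by omega)
    have h := two_bound hq hH
    rw [← hq] at h
    push_cast at h
    obtain ⟨j, rfl⟩ : ∃ j, m = 2 * j + 2 := ⟨m / 2 - 1, by omega⟩
    have hj : (18 : ℝ) ≤ j := by exact_mod_cast (show 18 ≤ j by omega)
    have hb := one_add_mul_le_pow (a := 2 / ((2 * j + 2 : ℕ) : ℝ)) (by
      have : (0:ℝ) ≤ 2 / ((2 * j + 2 : ℕ) : ℝ) := by positivity
      linarith) j
    set x : ℝ := ((2 * j + 2 : ℕ) : ℝ) with hx
    have hx' : x = 2 * j + 2 := by simp [hx]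
    have hx0 : 0 < x := by linarith
    have hb2 : (1.94 : ℝ) ≤ (1 + 2 / x) ^ j := by
      refine le_trans ?_ hb
      have : 1 + (j : ℝ) * (2 / x) = 2 - 2 / x := by
        field_simp; linarith
      rw [this]
      have : 2 / x ≤ 2 / 38 := by gcongr
      norm_num at this ⊢
      linarith
    have hb3 : (15 / 4 : ℝ) ≤ (1 + 2 / x) ^ (2 * j) := by
      rw [mul_comm, pow_mul]; nlinarith
    have hb4 : (15 / 4 : ℝ) * x ^ (2 * j) ≤ (x + 2) ^ (2 * j) := by
      have : (x + 2) = (1 + 2 / x) * x := by field_simp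
      rw [this, mul_pow]
      gcongr
    have e1 : (2 * (j:ℝ) + 2 + 2) = x + 2 := by rw [hx']
    try rw [e1] at h
    rw [pow_add (x + 2) (2 * j) 2, ← mul_assoc] at h
    have h5 : 4 * (x + 2) ^ (2 * j) ≤ maxDet (2 * j + 2) ^ 2 :=
      le_of_mul_le_mul_right h (by positivity)
    rw [pow_add, ← mul_assoc]
    gcongr
    linarith
  · obtain ⟨q, hq⟩ : ∃ q, m + 1 = 4 * q := ⟨m / 4 + 1, by omega⟩
    obtain ⟨H, hH⟩ := hc q (by omega)
    have h := one_bound hq hH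
    rw [← hq] at h
    push_cast at h
    obtain ⟨j, rfl⟩ : ∃ j, m = j + 1 := ⟨m - 1, by omega⟩
    set x : ℝ := ((j + 1 : ℕ) : ℝ) with hx
    have e1 : ((j:ℝ) + 1 + 1) = x + 1 := by simp [hx]
    try rw [e1] at h
    rw [pow_succ] at h
    have h5 : (x + 1) ^ j ≤ maxDet (j + 1) ^ 2 := le_of_mul_le_mul_right h (by positivity)
    have h6 : x ^ j ≤ (x + 1) ^ j := by gcongr; linarith
    have hp : 0 ≤ x ^ j := by positivity
    calc 15 * x ^ (j+1) = x ^ j * (15 * x) := by ring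
      _ ≤ maxDet (j + 1) ^ 2 * x ^ 2 := by
        gcongr
        · exact h6.trans h5
        · nlinarith

noncomputable def gfun (x : ℝ) : ℝ := Real.negMulLog x - Real.negMulLog (1 - x)

lemma gfun_concave : ConcaveOn ℝ (Set.Icc 0 (1/2)) gfun := by
  have hder : ∀ x ∈ Set.Ioo (0:ℝ) (1/2),
      HasDerivAt gfun (- Real.log (x * (1 - x)) - 2) x := by
    intro x hx
    have h1 := Real.hasDerivAt_negMulLog hx.1.ne'
    have hx1 : 1 - x ≠ 0 := by linarith [hx.2]
    have h2 := (Real.hasDerivAt_negMulLog hx1).comp x ((hasDerivAt_id x).const_sub 1)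
    have h3 := h1.sub h2
    refine h3.congr_deriv ?_
    rw [Real.log_mul hx.1.ne' hx1]; ring
  apply AntitoneOn.concaveOn_of_deriv (convex_Icc _ _)
  · unfold gfun
    exact (Real.continuous_negMulLog.sub
      (Real.continuous_negMulLog.comp (continuous_const.sub continuous_id))).continuousOn
  · rw [interior_Icc]
    exact fun x hx => (hder x hx).differentiableAt.differentiableWithinAt
  · rw [interior_Icc]
    intro x hx y hy hxy
    rw [(hder x hx).deriv, (hder y hy).deriv]
    have : Real.log (x * (1 - x)) ≤ Real.log (y * (1 - y)) := by
      apply Real.log_le_log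
      · exact mul_pos hx.1 (by linarith [hx.2])
      · nlinarith [hx.1, hx.2, hy.1, hy.2]
    linarith

lemma gfun_quarter : (0.13 : ℝ) ≤ gfun (1/4) := by
  have h4 : Real.log 4 = 2 * Real.log 2 := by
    rw [show (4:ℝ) = 2 ^ 2 by norm_num, Real.log_pow]; norm_num
  unfold gfun Real.negMulLog
  rw [show (1 - 1/4 : ℝ) = 3 / 4 by norm_num, Real.log_div (by norm_num) (by norm_num),
    Real.log_div (by norm_num) (by norm_num), h4, Real.log_one]
  linarith [Real.log_two_lt_d9, Real.log_three_gt_d9]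

lemma log_forty : Real.log 40 = 3 * Real.log 2 + Real.log 5 := by
  rw [show (40:ℝ) = 2 ^ 3 * 5 by norm_num, Real.log_mul (by norm_num) (by norm_num), Real.log_pow]
  norm_num

lemma log_fifteen : Real.log 15 = Real.log 3 + Real.log 5 := by
  rw [show (15:ℝ) = 3 * 5 by norm_num, Real.log_mul (by norm_num) (by norm_num)]

lemma analytic {n d : ℝ} (hn : 40 ≤ n) (hd : 3 ≤ d) (hdn : d ≤ n / 2 - 5 * Real.log n) :
    2 * Real.log n - Real.log 15 < n * gfun (d / n) := by
  have l2 := Real.log_two_lt_d9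
  have l2' := Real.log_two_gt_d9
  have l3 := Real.log_three_lt_d9
  have l3' := Real.log_three_gt_d9
  have l5 := Real.log_five_gt_d9
  have l5' := Real.log_five_lt_d9
  have l40 := log_forty
  have l15 := log_fifteen
  have hn0 : 0 < n := by linarith
  have hlog : Real.log 40 ≤ Real.log n := Real.log_le_log (by norm_num) hn
  have hgq := gfun_quarter
  have hxd : n * (d / n) = d := by field_simp
  have hx2 : d / n ≤ 1 / 2 := by
    rw [div_le_iff₀ hn0]; linarith
  rcases le_total (1/4) (d / n) with hq | hq
  · have hc := gfun_concave.2
      (show (1/4 : ℝ) ∈ Set.Icc 0 (1/2) by constructor <;> norm_num)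
      (show (1/2 : ℝ) ∈ Set.Icc 0 (1/2) by constructor <;> norm_num)
      (show 0 ≤ 2 - 4 * (d / n) by linarith) (show 0 ≤ 4 * (d / n) - 1 by linarith) (by ring)
    have e : (2 - 4 * (d / n)) • (1/4 : ℝ) + (4 * (d / n) - 1) • (1/2 : ℝ) = d / n := by
      simp only [smul_eq_mul]; ring
    have ehalf : gfun (1/2) = 0 := by unfold gfun; norm_num
    rw [e, ehalf, smul_zero, add_zero, smul_eq_mul] at hc
    have h1 : n * ((2 - 4 * (d / n)) * gfun (1/4)) = (2 * n - 4 * d) * gfun (1/4) := by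
      rw [← mul_assoc, mul_sub]
      congr 1; linarith
    have h2 : 20 * Real.log n ≤ 2 * n - 4 * d := by linarith
    have h3 : 20 * Real.log n * 0.13 ≤ (2 * n - 4 * d) * gfun (1/4) := by
      apply mul_le_mul h2 hgq (by norm_num); linarith
    have h4 := mul_le_mul_of_nonneg_left hc hn0.le
    linarith
  · have h3n : 3 / n ≤ d / n := by gcongr
    have h := gfun_concave.min_le_of_mem_Icc (x := 3 / n) (y := 1/4) (z := d / n)
      ⟨by positivity, by linarith⟩ (by constructor <;> norm_num) ⟨h3n, hq⟩
    have hA : 2 * Real.log n - Real.log 15 < n * gfun (3 / n) := by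
      unfold gfun Real.negMulLog
      have e : 1 - 3 / n = (n - 3) / n := by field_simp
      have hlb : -3 ≤ (n - 3) * Real.log (1 - 3 / n) := by
        rw [e]
        have h1 := Real.one_sub_inv_le_log_of_pos (x := (n - 3) / n) (div_pos (by linarith) hn0)
        have h2 : (n - 3) * (1 - ((n - 3) / n)⁻¹) = -3 := by
          have : n - 3 ≠ 0 := by linarith
          field_simp; ring
        rw [← h2]
        exact mul_le_mul_of_nonneg_left h1 (by linarith)
      have e2 : n * (-(3 / n) * Real.log (3 / n) - -(1 - 3 / n) * Real.log (1 - 3 / n))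
          = -3 * (Real.log 3 - Real.log n) + (n - 3) * Real.log (1 - 3 / n) := by
        rw [Real.log_div (by norm_num) hn0.ne']
        generalize Real.log (1 - 3 / n) = z
        field_simp
        ring
      rw [e2]
      linarith
    have hB : 2 * Real.log n - Real.log 15 < n * gfun (1/4) := by
      have h1 : Real.log (n / 40) ≤ n / 40 - 1 := Real.log_le_sub_one_of_pos (by positivity)
      rw [Real.log_div hn0.ne' (by norm_num)] at h1
      have h2 : n * 0.13 ≤ n * gfun (1/4) := by gcongr
      linarith
    rcases min_le_iff.1 h with h | h
    · exact hA.trans_le (mul_le_mul_of_nonneg_left h hn0.le)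
    · exact hB.trans_le (mul_le_mul_of_nonneg_left h hn0.le)

lemma n_ge_forty {n : ℝ} (hn : 1 ≤ n) (h : 3 ≤ n / 2 - 5 * Real.log n) : 40 ≤ n := by
  by_contra! hlt
  have h' := strictConcaveOn_log_Ioi.concaveOn.2 (show (1 : ℝ) ∈ Set.Ioi 0 by simp)
    (show (40 : ℝ) ∈ Set.Ioi 0 by simp)
    (show 0 ≤ (40 - n) / 39 by linarith) (show 0 ≤ (n - 1) / 39 by linarith) (by ring)
  simp only [smul_eq_mul, Real.log_one, mul_zero, zero_add] at h'
  rw [show (40 - n) / 39 * 1 + (n - 1) / 39 * 40 = n by ring, log_forty] at h'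
  have : (n - 1) / 39 * 3.68 ≤ (n - 1) / 39 * (3 * Real.log 2 + Real.log 5) := by
    apply mul_le_mul_of_nonneg_left _ (by linarith)
    linarith [Real.log_two_gt_d9, Real.log_five_gt_d9]
  linarith

/-- Assuming the Hadamard conjecture, a Hadamard matrix of order `n` has no maxdet
submatrix of order `m` with `n/2 + 5 ln n ≤ m < n - 2`. -/
theorem excluded_interval_maxdet_submatrix
    (hadamard_conjecture : ∀ k : ℕ, 0 < k →
      ∃ H : Matrix (Fin (4 * k)) (Fin (4 * k)) ℝ, IsHadamardMatrix H)
    {n m : ℕ} (H : Matrix (Fin n) (Fin n) ℝ) (hH : IsHadamardMatrix H)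
    (hmn : m < n)
    (f g : Fin m → Fin n) (hf : Function.Injective f) (hg : Function.Injective g)
    (hmax : |(H.submatrix f g).det| = maxDet m) :
    (m : ℝ) < (n : ℝ) / 2 + 5 * Real.log n ∨ n - 2 ≤ m := by
  by_contra! hcon
  obtain ⟨h1, h2⟩ := hcon
  obtain ⟨d, hd⟩ : ∃ d, m + d = n := ⟨n - m, by omega⟩
  have hd3 : 3 ≤ d := by omega
  have hd3R : (3 : ℝ) ≤ d := by exact_mod_cast hd3
  have hdR : (m : ℝ) + d = n := by exact_mod_cast hd
  have hn1 : (1 : ℝ) ≤ n := by exact_mod_cast (show 1 ≤ n by omega)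
  have hn40 : (40 : ℝ) ≤ n := n_ge_forty hn1 (by linarith)
  have hlog40 : Real.log 40 ≤ Real.log n := Real.log_le_log (by norm_num) hn40
  have hm38R : (38 : ℝ) ≤ m := by
    rw [log_forty] at hlog40
    linarith [Real.log_two_gt_d9, Real.log_five_gt_d9]
  have hm38 : 38 ≤ m := by exact_mod_cast hm38R
  have hlow := lower_bound hadamard_conjecture m hm38
  rw [← hmax, sq_abs] at hlow
  obtain ⟨e1, he1⟩ := extend_equiv hd f hf
  obtain ⟨e2, he2⟩ := extend_equiv hd g hg
  have hj := jacobi (by omega) hd hH e1 e2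
  simp only [he1, he2] at hj
  have hD := hadamard_ineq (H.submatrix (fun i => e1 (Sum.inr i)) (fun i => e2 (Sum.inr i)))
    (fun i j => hH.1 _ _)
  have hn0 : (0:ℝ) < n := by linarith
  have hm0 : (0:ℝ) < m := by linarith
  have hd0 : (0:ℝ) < d := by linarith
  have hup : (H.submatrix f g).det ^ 2 * (n : ℝ) ^ d ≤ n ^ m * d ^ d := by
    refine hj.le.trans ?_
    gcongr
  have hfin : 15 * (m : ℝ) ^ m * n ^ d ≤ n ^ m * d ^ d * m ^ 2 := by
    calc 15 * (m : ℝ) ^ m * n ^ d ≤ (H.submatrix f g).det ^ 2 * (m : ℝ) ^ 2 * n ^ d := by gcongr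
      _ = (H.submatrix f g).det ^ 2 * (n : ℝ) ^ d * m ^ 2 := by ring
      _ ≤ _ := by gcongr
  have hl := Real.log_le_log (by positivity) hfin
  rw [Real.log_mul (by positivity) (by positivity), Real.log_mul (by positivity) (by positivity),
    Real.log_mul (by positivity) (by positivity), Real.log_mul (by positivity) (by positivity)] at hl
  simp only [Real.log_pow] at hl
  have ha := analytic hn40 hd3R (by linarith)
  have hgv : (n:ℝ) * gfun (d / n)
      = -d * (Real.log d - Real.log n) + m * (Real.log m - Real.log n) := by
    unfold gfun Real.negMulLog
    have e : 1 - (d:ℝ) / n = m / n := by field_simp; linarith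
    rw [e, Real.log_div hd0.ne' hn0.ne', Real.log_div hm0.ne' hn0.ne']
    field_simp
    ring
  have hlm : Real.log m ≤ Real.log n := Real.log_le_log hm0 (by linarith)
  rw [hgv] at ha
  push_cast at hl
  linarith
end

section
/- Let m ≥ 4 be an integer, and assume that for every positive integer k with k ≤ (m+2)/4 there exists a Hadamard matrix of order 4k. Then D(m) ≥ 4·m^{m/2 − 1}. -/
lemma pm1_bdd (k : ℕ) :
    BddAbove {x : ℝ | ∃ A : Matrix (Fin k) (Fin k) ℝ, IsPM1 A ∧ x = |A.det|} := by
  refine ⟨(Fintype.card (Fin k)).factorial • (1:ℝ) ^ Fintype.card (Fin k), ?_⟩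
  rintro x ⟨A, hA, rfl⟩
  refine Matrix.det_le (abv := AbsoluteValue.abs) (x := (1:ℝ)) ?_
  intro i j
  rcases hA i j with h | h <;> simp [h]

lemma key_of_sq {m : ℕ} (hm : 4 ≤ m) {ι : Type} [Fintype ι] [DecidableEq ι] (e : Fin m ≃ ι)
    (A : Matrix ι ι ℝ) (hA : ∀ i j, A i j = 1 ∨ A i j = -1)
    (h : 16 * (m : ℝ) ^ (m - 2) ≤ A.det ^ 2) :
    4 * (m : ℝ) ^ ((m : ℝ) / 2 - 1) ≤ maxDet m := by
  have h1 : |A.det| ≤ maxDet m := by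
    refine le_csSup (pm1_bdd m) ⟨A.submatrix e e, fun i j => hA _ _, ?_⟩
    rw [Matrix.det_submatrix_equiv_self]
  refine le_trans ?_ h1
  refine (pow_le_pow_iff_left₀ (by positivity) (abs_nonneg _) two_ne_zero).mp ?_
  rw [sq_abs]
  refine le_trans (le_of_eq ?_) h
  have hm0 : (0:ℝ) < m := by exact_mod_cast (by omega : 0 < m)
  rw [mul_pow, ← Real.rpow_natCast (n := 2), ← Real.rpow_natCast (n := 2),
    ← Real.rpow_mul hm0.le, ← Real.rpow_natCast (n := m - 2)]
  congr 1
  · norm_num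
  · congr 1
    rw [Nat.cast_sub (by omega)]
    push_cast
    ring

lemma det_sq {ι : Type} [Fintype ι] [DecidableEq ι] (K : Matrix ι ι ℝ) (N : ℝ)
    (h : K * K.transpose = N • (1 : Matrix ι ι ℝ)) : K.det ^ 2 = N ^ Fintype.card ι := by
  have := congrArg Matrix.det h
  simpa [Matrix.det_mul, Matrix.det_smul, ← pow_two] using this

lemma minor_sq {m q : ℕ} (K : Matrix (Fin m ⊕ Fin q) (Fin m ⊕ Fin q) ℝ) (N : ℝ)
    (h : K * K.transpose = N • (1 : Matrix (Fin m ⊕ Fin q) (Fin m ⊕ Fin q) ℝ)) :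
    K.toBlocks₁₁.det ^ 2 * N ^ (2 * q) = N ^ (m + q) * K.toBlocks₂₂.det ^ 2 := by
  have hd := det_sq K N h
  obtain ⟨A, B, C, D, rfl⟩ : ∃ A B C D, K = Matrix.fromBlocks A B C D :=
    ⟨_, _, _, _, (Matrix.fromBlocks_toBlocks K).symm⟩
  rw [Matrix.fromBlocks_transpose, Matrix.fromBlocks_multiply, ← Matrix.fromBlocks_one,
    Matrix.fromBlocks_smul, Matrix.fromBlocks_inj] at h
  obtain ⟨-, h2, -, h4⟩ := h
  have e : Matrix.fromBlocks A B C D * Matrix.fromBlocks 1 C.transpose 0 D.transpose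
      = Matrix.fromBlocks A 0 C (N • 1) := by
    rw [Matrix.fromBlocks_multiply, h2, h4]
    simp
  have e2 := congrArg Matrix.det e
  rw [Matrix.det_mul, Matrix.det_fromBlocks_zero₂₁, Matrix.det_fromBlocks_zero₁₂,
    Matrix.det_smul] at e2
  simp only [Matrix.det_one, mul_one, one_mul, Matrix.det_transpose, Fintype.card_fin] at e2
  simp only [Matrix.toBlocks_fromBlocks₁₁, Matrix.toBlocks_fromBlocks₂₂]
  simp only [Fintype.card_sum, Fintype.card_fin] at hd
  rw [← hd, ← mul_pow, e2]
  ring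

lemma had_sub {n : ℕ} {ι : Type} [Fintype ι] [DecidableEq ι] {H : Matrix (Fin n) (Fin n) ℝ}
    (hH : IsHadamardMatrix H) (e f : ι ≃ Fin n) :
    H.submatrix e f * (H.submatrix e f).transpose = (n : ℝ) • (1 : Matrix ι ι ℝ) := by
  rw [Matrix.transpose_submatrix, Matrix.submatrix_mul_equiv, hH.2]
  ext i j
  simp [Matrix.one_apply]

lemma pm_sq {x : ℝ} (h : x = 1 ∨ x = -1) : x * x = 1 := by
  rcases h with h | h <;> simp [h]

lemma minor_one {m : ℕ} {H : Matrix (Fin (m + 1)) (Fin (m + 1)) ℝ} (hm : 1 ≤ m)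
    (hH : IsHadamardMatrix H) :
    ∃ A : Matrix (Fin m) (Fin m) ℝ, IsPM1 A ∧ A.det ^ 2 = ((m : ℝ) + 1) ^ (m - 1) := by
  have h := minor_sq _ _ (had_sub hH (finSumFinEquiv (m := m) (n := 1)) finSumFinEquiv)
  refine ⟨(H.submatrix finSumFinEquiv finSumFinEquiv).toBlocks₁₁, fun i j => hH.1 _ _, ?_⟩
  · rw [Matrix.det_fin_one] at h
    have h2 := pm_sq (hH.1 (finSumFinEquiv (Sum.inr (0 : Fin 1))) (finSumFinEquiv (Sum.inr (0 : Fin 1))))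
    rw [pow_two (Matrix.toBlocks₂₂ _ _ _)] at h
    have h3 := h.trans (congrArg (fun t => ((m + 1 : ℕ) : ℝ) ^ (m + 1) * t) h2)
    simp only [mul_one] at h3
    have hp : (0:ℝ) < ((m + 1 : ℕ) : ℝ) ^ 2 := by positivity
    push_cast at h3 hp
    apply mul_right_cancel₀ hp.ne'
    rw [← pow_add, show m - 1 + 2 = m + 1 by omega, ← h3]

lemma minor_two {m : ℕ} {H : Matrix (Fin (m + 2)) (Fin (m + 2)) ℝ} (hm : 2 ≤ m)
    (hH : IsHadamardMatrix H) :
    ∃ A : Matrix (Fin m) (Fin m) ℝ, IsPM1 A ∧ A.det ^ 2 = 4 * ((m : ℝ) + 2) ^ (m - 2) := by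
  let e : Fin m ⊕ Fin 2 ≃ Fin (m + 2) := finSumFinEquiv
  set r0 := e (Sum.inr 0) with hr0
  set r1 := e (Sum.inr 1) with hr1
  have hne : r0 ≠ r1 := by simp [r0, r1]
  have horth : ∑ j, H r0 j * H r1 j = 0 := by
    have := congrFun (congrFun hH.2 r0) r1
    simpa [Matrix.mul_apply, hne] using this
  have hp : ∀ j, H r0 j * H r1 j = 1 ∨ H r0 j * H r1 j = -1 := by
    intro j
    rcases hH.1 r0 j with h | h <;> rcases hH.1 r1 j with h' | h' <;> simp [h, h']
  obtain ⟨j0, hj0⟩ : ∃ j, H r0 j * H r1 j = 1 := by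
    by_contra hc
    push Not at hc
    have : ∀ j, H r0 j * H r1 j = -1 := fun j => (hp j).resolve_left (hc j)
    simp [this] at horth
    have : (0:ℝ) ≤ m := Nat.cast_nonneg m
    linarith
  obtain ⟨j1, hj1⟩ : ∃ j, H r0 j * H r1 j = -1 := by
    by_contra hc
    push Not at hc
    have : ∀ j, H r0 j * H r1 j = 1 := fun j => (hp j).resolve_right (hc j)
    simp [this] at horth
    have : (0:ℝ) ≤ m := Nat.cast_nonneg m
    linarith
  have hjne : j0 ≠ j1 := by
    rintro rfl
    linarith
  obtain ⟨f, hf0, hf1⟩ : ∃ f : Fin m ⊕ Fin 2 ≃ Fin (m + 2),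
      f (Sum.inr 0) = j0 ∧ f (Sum.inr 1) = j1 := by
    let s := Equiv.swap r0 j0
    refine ⟨(e.trans s).trans (Equiv.swap (s r1) j1), ?_, ?_⟩
    · simp only [Equiv.trans_apply, ← hr0]
      have : s r0 = j0 := Equiv.swap_apply_left _ _
      rw [this, Equiv.swap_apply_of_ne_of_ne _ hjne]
      rw [← this]
      exact fun h => hne (s.injective h)
    · simp only [Equiv.trans_apply, ← hr1]
      exact Equiv.swap_apply_left _ _
  have h := minor_sq _ _ (had_sub hH e f)
  have hD : (H.submatrix e f).toBlocks₂₂.det ^ 2 = 4 := by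
    rw [Matrix.det_fin_two]
    simp only [Matrix.toBlocks₂₂, Matrix.of_apply, Matrix.submatrix_apply, hf0, hf1, ← hr0, ← hr1]
    have a := pm_sq (hH.1 r0 j0)
    have b := pm_sq (hH.1 r1 j1)
    have c := pm_sq (hH.1 r0 j1)
    have d := pm_sq (hH.1 r1 j0)
    calc _ = (H r0 j0 * H r0 j0) * (H r1 j1 * H r1 j1) + (H r0 j1 * H r0 j1) * (H r1 j0 * H r1 j0)
          - 2 * (H r0 j0 * H r1 j0) * (H r0 j1 * H r1 j1) := by ring
      _ = 4 := by rw [a, b, c, d, hj0, hj1]; norm_num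
  refine ⟨(H.submatrix e f).toBlocks₁₁, fun i j => hH.1 _ _, ?_⟩
  rw [hD] at h
  have hp : (0:ℝ) < ((m + 2 : ℕ) : ℝ) ^ (2 * 2) := by positivity
  apply mul_right_cancel₀ hp.ne'
  rw [h]
  push_cast
  rw [mul_assoc, ← pow_add, show m - 2 + 2 * 2 = m + 2 by omega]
  ring

lemma border {n : ℕ} [NeZero n] {H : Matrix (Fin n) (Fin n) ℝ} (hn : 2 ≤ n)
    (hH : IsHadamardMatrix H) :
    ∃ A : Matrix (Fin n ⊕ Fin 1) (Fin n ⊕ Fin 1) ℝ, (∀ i j, A i j = 1 ∨ A i j = -1) ∧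
      A.det ^ 2 = (4 * ((n : ℝ) - 1)) ^ 2 * (n : ℝ) ^ (n - 2) := by
  have hn0 : (n : ℝ) ≠ 0 := NeZero.ne _
  have hT : H.transpose * H = (n : ℝ) • (1 : Matrix (Fin n) (Fin n) ℝ) := by
    have h1 : H * ((n : ℝ)⁻¹ • H.transpose) = 1 := by
      rw [Matrix.mul_smul, hH.2, smul_smul, inv_mul_cancel₀ hn0, one_smul]
    have h2 := mul_eq_one_comm.mp h1
    rw [Matrix.smul_mul] at h2
    rw [← h2, smul_smul, mul_inv_cancel₀ hn0, one_smul]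
  have hd := det_sq H _ hH.2
  rw [Fintype.card_fin] at hd
  have h00 := pm_sq (hH.1 0 0)
  let U : Matrix (Fin n) (Fin 1) ℝ := fun i _ => H i 0 - 2 * (if i = 0 then H 0 0 else 0)
  let V : Matrix (Fin 1) (Fin n) ℝ := fun _ j => H 0 j * H 0 0 - 2 * (if j = 0 then 1 else 0)
  have hw : ∀ j, (H.transpose * U) j 0 = (if j = 0 then (n : ℝ) else 0) - 2 * (H 0 j * H 0 0) := by
    intro j
    have h1 : ∑ i, H i j * H i 0 = if j = 0 then (n : ℝ) else 0 := by
      have := congrFun (congrFun hT j) 0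
      simpa [Matrix.mul_apply, Matrix.one_apply] using this
    rw [Matrix.mul_apply, ← h1]
    simp only [Matrix.transpose_apply, U, mul_sub, Finset.sum_sub_distrib]
    congr 1
    simp
    ring
  have hVw : (V * (H.transpose * U)) 0 0 = -(3 * (n : ℝ) - 4) := by
    rw [Matrix.mul_apply]
    have : ∀ j, V 0 j * (H.transpose * U) j 0 =
        (if j = 0 then 4 - (n : ℝ) else 0) - 2 := by
      intro j
      rw [hw]
      have hj := pm_sq (hH.1 0 j)
      simp only [V]
      split_ifs with h
      · subst h
        rw [h00]
        ring
      · linear_combination (-2 * (H 0 0 * H 0 0)) * hj - 2 * h00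
    simp only [this, Finset.sum_sub_distrib]
    simp
    ring
  refine ⟨Matrix.fromBlocks H U V 1, ?_, ?_⟩
  · rintro (i | i) (j | j)
    · exact hH.1 i j
    · rw [Matrix.fromBlocks_apply₁₂]
      simp only [U]
      split_ifs with h
      · subst h
        rcases hH.1 0 0 with h | h <;> rw [h] <;> norm_num
      · simpa using hH.1 i 0
    · rw [Matrix.fromBlocks_apply₂₁]
      simp only [V]
      split_ifs with h
      · subst h
        rw [h00]; norm_num
      · rcases hH.1 0 0 with h | h <;> rcases hH.1 0 j with h' | h' <;> rw [h, h'] <;> norm_num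
    · left
      simp [Subsingleton.elim i j]
  · have e : Matrix.fromBlocks H.transpose 0 (-(V * H.transpose)) ((n : ℝ) • 1) *
        Matrix.fromBlocks H U V 1 =
        Matrix.fromBlocks ((n : ℝ) • 1) (H.transpose * U) 0
          ((n : ℝ) • 1 - V * (H.transpose * U)) := by
      rw [Matrix.fromBlocks_multiply, hT]
      congr 1
      · simp
      · simp
      · rw [Matrix.neg_mul, Matrix.mul_assoc, hT]; simp
      · rw [Matrix.neg_mul, Matrix.mul_assoc]; simp [sub_eq_add_neg, add_comm]
    have e2 := congrArg Matrix.det e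
    rw [Matrix.det_mul, Matrix.det_fromBlocks_zero₂₁, Matrix.det_fromBlocks_zero₁₂,
      Matrix.det_smul, Matrix.det_smul, Matrix.det_fin_one (_ - _), Matrix.sub_apply, hVw] at e2
    simp only [Matrix.det_transpose, Matrix.det_one, mul_one, Fintype.card_fin, pow_one, Matrix.smul_apply, Matrix.one_apply_eq, smul_eq_mul] at e2
    have e3 := congrArg (· ^ 2) e2
    simp only [mul_pow, hd] at e3
    have hp : (n : ℝ) ^ n * (n : ℝ) ^ 2 ≠ 0 := by positivity
    apply mul_left_cancel₀ hp
    rw [e3]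
    obtain ⟨k, rfl⟩ := Nat.exists_eq_add_of_le hn
    rw [show 2 + k - 2 = k by omega]
    push_cast
    ring

lemma ineq_border {n : ℕ} (hn : 4 ≤ n) :
    16 * ((n + 1 : ℕ) : ℝ) ^ (n + 1 - 2) ≤ (4 * ((n : ℝ) - 1)) ^ 2 * (n : ℝ) ^ (n - 2) := by
  rcases Nat.eq_or_lt_of_le hn with rfl | h
  · norm_num
  · have hn5 : (5:ℝ) ≤ n := by exact_mod_cast h
    have h1 : (1 + 1 / (n:ℝ)) ^ n ≤ 3 := by
      have a : 1 + 1 / (n:ℝ) ≤ Real.exp (1 / n) := by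
        rw [add_comm]; exact Real.add_one_le_exp _
      calc (1 + 1 / (n:ℝ)) ^ n ≤ Real.exp (1 / n) ^ n := by gcongr
        _ = Real.exp 1 := by
          rw [← Real.exp_nat_mul]; congr 1; field_simp
        _ ≤ 3 := by linarith [Real.exp_one_lt_d9]
    have h2 : ((n:ℝ) + 1) ^ n ≤ 3 * (n:ℝ) ^ n := by
      have : ((n:ℝ) + 1) ^ n = (1 + 1 / (n:ℝ)) ^ n * (n:ℝ) ^ n := by
        rw [← mul_pow]; congr 1; field_simp
      rw [this]; gcongr
    obtain ⟨k, rfl⟩ := Nat.exists_eq_add_of_le (show 2 ≤ n by omega)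
    rw [show 2 + k + 1 - 2 = k + 1 by omega, show 2 + k - 2 = k by omega]
    push_cast at *
    set x : ℝ := 2 + k with hx
    have hxk : 0 < x ^ k := by positivity
    have h3 : (x + 1) ^ (k + 1) * (x + 1) ≤ 3 * x ^ 2 * x ^ k := by
      calc _ = (x + 1) ^ (2 + k) := by ring
        _ ≤ _ := h2
        _ = _ := by ring
    have h4 : 3 * x ^ 2 ≤ (x - 1) ^ 2 * (x + 1) := by nlinarith
    have h5 : (x + 1) ^ (k + 1) * (x + 1) ≤ ((x - 1) ^ 2 * x ^ k) * (x + 1) := by nlinarith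
    have h6 := le_of_mul_le_mul_right h5 (by linarith)
    linarith

lemma ineq_one {m : ℕ} (hm : 9 ≤ m) :
    16 * (m : ℝ) ^ (m - 2) ≤ ((m : ℝ) + 1) ^ (m - 1) := by
  have hm9 : (9:ℝ) ≤ m := by exact_mod_cast hm
  have h := one_add_mul_le_pow (a := 1 / (m:ℝ)) (by have : 0 ≤ 1 / (m:ℝ) := by positivity
                                                    linarith) (m - 1)
  have e : ((m : ℝ) + 1) ^ (m - 1) = (1 + 1 / (m:ℝ)) ^ (m - 1) * (m:ℝ) * (m:ℝ) ^ (m - 2) := by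
    rw [mul_assoc, ← pow_succ', show m - 2 + 1 = m - 1 by omega, ← mul_pow]
    congr 1; field_simp
  rw [e]
  gcongr
  rw [Nat.cast_sub (by omega)] at h
  have : (1 + ((m:ℝ) - (1:ℕ)) * (1 / (m:ℝ))) * m = 2 * m - 1 := by
    push_cast; field_simp; ring
  nlinarith

lemma ineq_two {x : ℕ} (hx : 5 ≤ x) :
    16 * ((2 * x : ℕ) : ℝ) ^ (2 * x - 2) ≤ 4 * (((2 * x : ℕ) : ℝ) + 2) ^ (2 * x - 2) := by
  have key : 2 * (x:ℝ) ^ (x - 1) ≤ ((x:ℝ) + 1) ^ (x - 1) := by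
    obtain ⟨k, rfl⟩ := Nat.exists_eq_add_of_le (show 3 ≤ x by omega)
    have hk : (2:ℝ) ≤ k := by exact_mod_cast (by omega : 2 ≤ k)
    rw [show 3 + k - 1 = k + 2 by omega]
    have h1 : ∑ i ∈ ({k + 2, k + 1, k} : Finset ℕ),
        ((3 + k : ℕ) : ℝ) ^ i * 1 ^ (k + 2 - i) * ((k + 2).choose i : ℝ) ≤
          (((3 + k : ℕ) : ℝ) + 1) ^ (k + 2) := by
      rw [add_pow]
      apply Finset.sum_le_sum_of_subset_of_nonneg
      · intro i hi
        simp at hi ⊢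
        omega
      · intros; positivity
    refine le_trans ?_ h1
    rw [Finset.sum_insert (by simp), Finset.sum_insert (by simp), Finset.sum_singleton]
    have c2 : ((k + 2).choose k : ℝ) = (k + 2) * (k + 1) / 2 := by
      rw [Nat.choose_symm_add, Nat.cast_choose_two]; push_cast; ring
    have c1 : ((k + 2).choose (k + 1) : ℝ) = k + 2 := by
      rw [show k + 2 = (k + 1) + 1 by rfl, Nat.choose_succ_self_right]; push_cast; ring
    rw [c1, c2]
    push_cast
    simp only [one_pow, mul_one, Nat.choose_self, Nat.cast_one]
    have hp : (0:ℝ) < (3 + (k:ℝ)) ^ k := by positivity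
    have : 2 * (3 + (k:ℝ)) ^ 2 ≤ (3 + (k:ℝ)) ^ 2 + (3 + k) * (k + 2) + (k + 2) * (k + 1) / 2 := by
      nlinarith
    calc 2 * (3 + (k:ℝ)) ^ (k + 2) = 2 * (3 + (k:ℝ)) ^ 2 * (3 + (k:ℝ)) ^ k := by ring
      _ ≤ ((3 + (k:ℝ)) ^ 2 + (3 + k) * (k + 2) + (k + 2) * (k + 1) / 2) * (3 + (k:ℝ)) ^ k := by
        gcongr
      _ = _ := by ring
  have k2 : (2 * (x:ℝ) ^ (x - 1)) ^ 2 ≤ (((x:ℝ) + 1) ^ (x - 1)) ^ 2 := by gcongr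
  have e1 : ((2 * x : ℕ) : ℝ) ^ (2 * x - 2) = 2 ^ (2 * x - 2) * ((x:ℝ) ^ (x - 1)) ^ 2 := by
    rw [← pow_mul, show (x - 1) * 2 = 2 * x - 2 by omega, ← mul_pow]; push_cast; rfl
  have e2 : (((2 * x : ℕ) : ℝ) + 2) ^ (2 * x - 2) =
      2 ^ (2 * x - 2) * (((x:ℝ) + 1) ^ (x - 1)) ^ 2 := by
    rw [← pow_mul, show (x - 1) * 2 = 2 * x - 2 by omega, ← mul_pow]; push_cast; ring_nf
  rw [e1, e2]
  have hp : (0:ℝ) < 2 ^ (2 * x - 2) := by positivity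
  rw [mul_pow] at k2
  nlinarith

lemma six : ∃ A : Matrix (Fin 6) (Fin 6) ℝ, IsPM1 A ∧ A.det = 160 := by
  let A : Matrix (Fin 6) (Fin 6) ℤ := !![1, 1, 1, 1, 1, 1; -1, 1, 1, -1, -1, -1; 1, -1, 1, 1, 1, -1; 1, 1, -1, -1, 1, -1; -1, 1, -1, 1, 1, -1; 1, 1, -1, 1, -1, -1]
  let L : Matrix (Fin 6) (Fin 6) ℤ := !![1, 0, 0, 0, 0, 0; 1, 1, 0, 0, 0, 0; 0, 1, 1, 0, 0, 0; -1, 1, 1, 1, 0, 0; -1, 1, 2, 1, 1, 0; -2, 2, 3, 1, 1, 1]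
  let U : Matrix (Fin 6) (Fin 6) ℤ := !![1, 1, 1, 1, 1, 1; 0, 2, 2, 0, 0, 0; 0, 0, 2, 0, 0, -2; 0, 0, 0, -2, 0, -4; 0, 0, 0, 0, 2, -6; 0, 0, 0, 0, 0, -10]
  have hLU : L * A = U := by decide +kernel
  have hL : L.det = 1 := by
    rw [Matrix.det_of_isLowerTriangular L (by intro i j h; replace h : i < j := h; fin_cases i <;> fin_cases j <;> first | rfl | exact absurd h (by decide))]
    decide +kernel
  have hU : U.det = 160 := by
    rw [Matrix.det_of_isUpperTriangular (M := U) (by intro i j h; replace h : j < i := h; fin_cases i <;> fin_cases j <;> first | rfl | exact absurd h (by decide))]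
    decide +kernel
  have hA : A.det = 160 := by
    rw [← hU, ← hLU, Matrix.det_mul, hL, one_mul]
  have hpm : ∀ i j, A i j = 1 ∨ A i j = -1 := by
    intro i j
    fin_cases i <;> fin_cases j <;> simp [A]
  refine ⟨A.map (Int.castRingHom ℝ), fun i j => ?_, ?_⟩
  · rcases hpm i j with h | h <;> simp [h]
  · rw [← RingHom.mapMatrix_apply, ← RingHom.map_det, hA]; norm_num

lemma seven : ∃ A : Matrix (Fin 7) (Fin 7) ℝ, IsPM1 A ∧ A.det = -576 := by
  let A : Matrix (Fin 7) (Fin 7) ℤ := !![1, -1, 1, 1, 1, 1, 1; -1, -1, -1, 1, -1, -1, 1; -1, 1, 1, -1, -1, 1, 1; -1, 1, -1, 1, 1, 1, 1; 1, 1, -1, 1, -1, -1, 1; 1, -1, -1, -1, -1, 1, -1; -1, 1, 1, 1, -1, 1, -1]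
  let L : Matrix (Fin 7) (Fin 7) ℤ := !![1, 0, 0, 0, 0, 0, 0; 1, 1, 0, 0, 0, 0, 0; 1, 0, 1, 0, 0, 0, 0; 1, 0, 0, 1, 0, 0, 0; 0, 1, 1, -1, 1, 0, 0; 1, 0, 1, 1, 0, 1, 0; -3, -2, -5, -1, -2, 1, 4]
  let U : Matrix (Fin 7) (Fin 7) ℤ := !![1, -1, 1, 1, 1, 1, 1; 0, -2, 0, 2, 0, 0, 2; 0, 0, 2, 0, 0, 2, 2; 0, 0, 0, 2, 2, 2, 2; 0, 0, 0, 0, -4, -2, 2; 0, 0, 0, 0, 0, 4, 2; 0, 0, 0, 0, 0, 0, -18]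
  have hLU : L * A = U := by decide +kernel
  have hL : L.det = 4 := by
    rw [Matrix.det_of_isLowerTriangular L (by intro i j h; replace h : i < j := h; fin_cases i <;> fin_cases j <;> first | rfl | exact absurd h (by decide))]
    decide +kernel
  have hU : U.det = -2304 := by
    rw [Matrix.det_of_isUpperTriangular (M := U) (by intro i j h; replace h : j < i := h; fin_cases i <;> fin_cases j <;> first | rfl | exact absurd h (by decide))]
    decide +kernel
  have hA : A.det = -576 := by
    have := congrArg Matrix.det hLU
    rw [Matrix.det_mul, hL, hU] at this
    omega
  have hpm : ∀ i j, A i j = 1 ∨ A i j = -1 := by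
    intro i j
    fin_cases i <;> fin_cases j <;> simp [A]
  refine ⟨A.map (Int.castRingHom ℝ), fun i j => ?_, ?_⟩
  · rcases hpm i j with h | h <;> simp [h]
  · rw [← RingHom.mapMatrix_apply, ← RingHom.map_det, hA]; norm_num

/-- Lower bound `D(m) ≥ 4 m^{m/2-1}`, assuming Hadamard matrices of all orders
`4k ≤ m + 2` exist. -/
theorem maxDet_lower_bound {m : ℕ} (hm : 4 ≤ m)
    (had : ∀ k : ℕ, 0 < k → 4 * k ≤ m + 2 →
      ∃ H : Matrix (Fin (4 * k)) (Fin (4 * k)) ℝ, IsHadamardMatrix H) :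
    4 * (m : ℝ) ^ ((m : ℝ) / 2 - 1) ≤ maxDet m := by
  have had' : ∀ n : ℕ, 0 < n → n % 4 = 0 → n ≤ m + 2 →
      ∃ H : Matrix (Fin n) (Fin n) ℝ, IsHadamardMatrix H := by
    intro n h0 h1 h2
    obtain ⟨k, rfl⟩ : 4 ∣ n := Nat.dvd_of_mod_eq_zero h1
    exact had k (by omega) h2
  have h4 : m % 4 = 0 ∨ m % 4 = 1 ∨ m % 4 = 2 ∨ m % 4 = 3 := by omega
  rcases h4 with h | h | h | h
  · obtain ⟨H, hH⟩ := had' m (by omega) h (by omega)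
    refine key_of_sq hm (Equiv.refl _) H hH.1 ?_
    rw [det_sq H _ hH.2, Fintype.card_fin]
    have hm' : (4:ℝ) ≤ m := by exact_mod_cast hm
    calc 16 * (m:ℝ) ^ (m - 2) ≤ (m:ℝ) ^ 2 * (m:ℝ) ^ (m - 2) := by gcongr; nlinarith
      _ = (m:ℝ) ^ m := by rw [← pow_add]; congr 1; omega
  · obtain ⟨n, rfl⟩ : ∃ n, m = n + 1 := ⟨m - 1, by omega⟩
    obtain ⟨H, hH⟩ := had' n (by omega) (by omega) (by omega)
    have : NeZero n := ⟨by omega⟩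
    obtain ⟨A, hA, hd⟩ := border (by omega) hH
    refine key_of_sq hm finSumFinEquiv.symm A hA ?_
    rw [hd]
    exact ineq_border (by omega)
  · by_cases h6 : m = 6
    · subst h6
      obtain ⟨A, hA, hd⟩ := six
      refine key_of_sq hm (Equiv.refl _) A hA ?_
      rw [hd]; norm_num
    · obtain ⟨H, hH⟩ := had' (m + 2) (by omega) (by omega) (by omega)
      obtain ⟨A, hA, hd⟩ := minor_two (by omega) hH
      refine key_of_sq hm (Equiv.refl _) A hA ?_
      rw [hd]
      obtain ⟨x, rfl⟩ : ∃ x, m = 2 * x := ⟨m / 2, by omega⟩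
      exact ineq_two (by omega)
  · by_cases h7 : m = 7
    · subst h7
      obtain ⟨A, hA, hd⟩ := seven
      refine key_of_sq hm (Equiv.refl _) A hA ?_
      rw [hd]; norm_num
    · obtain ⟨H, hH⟩ := had' (m + 1) (by omega) (by omega) (by omega)
      obtain ⟨A, hA, hd⟩ := minor_one (by omega) hH
      refine key_of_sq hm (Equiv.refl _) A hA ?_
      rw [hd]
      exact ineq_one (by omega)
end

section
/- Let A be a {±1}-matrix of order n and let m be an integer with n ≥ m > 1. Then the mean value E(det(M)²) of det(M)², taken over all m×m submatrices M of A, satisfies E(det(M)²) ≤ n^m / C(n,m). Moreover, equality holds if and only if A is a Hadamard matrix. -/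
/-- The arithmetic mean of `det(M)^2` over all `m × m` submatrices `M` of `A`,
indexed by the `C(n,m)^2` pairs `(R, C)` of `m`-element row and column subsets. -/
noncomputable def avgMinorSq {n : ℕ} (A : Matrix (Fin n) (Fin n) ℝ) (m : ℕ) : ℝ :=
  (∑ R ∈ (Finset.powersetCard m (Finset.univ : Finset (Fin n))).attach,
    ∑ C ∈ (Finset.powersetCard m (Finset.univ : Finset (Fin n))).attach,
      (A.submatrix
        (fun i => (R.1.orderIsoOfFin (Finset.mem_powersetCard.mp R.2).2 i : Fin n))
        (fun j => (C.1.orderIsoOfFin (Finset.mem_powersetCard.mp C.2).2 j : Fin n))).det ^ 2)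
    / ((n.choose m : ℝ)) ^ 2

open Finset in
theorem aux_prod {ι : Type*} [Fintype ι] (l : ι → ℝ) (c : ℝ) (hc : 0 < c) (h0 : ∀ i, 0 ≤ l i)
    (hs : ∑ i, l i = Fintype.card ι * c) :
    ∏ i, l i ≤ c ^ Fintype.card ι ∧ (∏ i, l i = c ^ Fintype.card ι → ∀ i, l i = c) := by
  have hle : ∀ i, l i ≤ c * Real.exp (l i / c - 1) := fun i => by
    have h := Real.add_one_le_exp (l i / c - 1)
    have h2 := mul_le_mul_of_nonneg_left h hc.le
    have h3 : c * (l i / c - 1 + 1) = l i := by field_simp; ring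
    linarith
  have hR : ∏ i, c * Real.exp (l i / c - 1) = c ^ Fintype.card ι := by
    rw [Finset.prod_mul_distrib, ← Real.exp_sum, Finset.sum_sub_distrib, ← Finset.sum_div, hs]
    have : (Fintype.card ι : ℝ) * c / c = Fintype.card ι := by field_simp
    simp [this]
  refine ⟨hR ▸ Finset.prod_le_prod (fun i _ => h0 i) (fun i _ => hle i), ?_⟩
  intro he i
  by_contra hne
  have hpos : ∀ j ∈ (univ : Finset ι), 0 < l j := by
    intro j _
    refine lt_of_le_of_ne (h0 j) fun hj => ?_
    rw [Finset.prod_eq_zero (mem_univ j) hj.symm] at he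
    exact (pow_pos hc _).ne he
  have hlt : l i < c * Real.exp (l i / c - 1) := by
    have h := Real.add_one_lt_exp (x := l i / c - 1) (by
      intro h
      apply hne
      field_simp at h
      linarith)
    have h2 := mul_lt_mul_of_pos_left h hc
    have h3 : c * (l i / c - 1 + 1) = l i := by field_simp; ring
    linarith
  have := Finset.prod_lt_prod hpos (fun j _ => hle j) ⟨i, mem_univ i, hlt⟩
  rw [hR, he] at this
  exact lt_irrefl _ this

theorem aux_psd {ι : Type*} [Fintype ι] [DecidableEq ι] (G : Matrix ι ι ℝ) (hG : G.PosSemidef)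
    (c : ℝ) (hc : 0 < c) (hd : ∀ i, G i i = c) :
    G.det ≤ c ^ Fintype.card ι ∧ (G.det = c ^ Fintype.card ι → G = c • 1) := by
  have htr : ∑ i, hG.1.eigenvalues i = Fintype.card ι * c := by
    have := hG.1.trace_eq_sum_eigenvalues
    simp only [Matrix.trace, Matrix.diag, hd] at this
    simpa using this.symm
  have h := aux_prod _ c hc hG.eigenvalues_nonneg htr
  have hdet := hG.1.det_eq_prod_eigenvalues
  simp only [RCLike.ofReal_real_eq_id, id] at hdet
  rw [hdet]
  refine ⟨h.1, fun he => ?_⟩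
  have h2 : (RCLike.ofReal ∘ hG.1.eigenvalues : ι → ℝ) = fun _ => c := by
    funext i; simpa using h.2 he i
  have h3 := hG.1.spectral_theorem
  rw [h2] at h3
  have h4 : (Matrix.diagonal fun _ : ι => c) = c • (1 : Matrix ι ι ℝ) := by
    rw [Matrix.smul_one_eq_diagonal]
  rw [h4, map_smul, map_one] at h3
  exact h3

open Finset in
theorem aux_cb {n m : ℕ} (B : Matrix (Fin m) (Fin n) ℝ) :
    (B * B.transpose).det = ∑ C ∈ (Finset.powersetCard m (Finset.univ : Finset (Fin n))).attach,
      (B.submatrix id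
        (fun j => (C.1.orderIsoOfFin (Finset.mem_powersetCard.mp C.2).2 j : Fin n))).det ^ 2 := by
  have h1 : (B * B.transpose).det =
      ∑ f : Fin m → Fin n, (∏ i, B i (f i)) * (B.submatrix id f).det := by
    simp only [Matrix.det_apply', Matrix.mul_apply, prod_univ_sum, mul_sum, Fintype.piFinset_univ]
    rw [Finset.sum_comm]
    refine sum_congr rfl fun f _ => sum_congr rfl fun σ _ => ?_
    simp only [Matrix.transpose_apply, prod_mul_distrib, Matrix.submatrix_apply, id]
    ring
  have h2 : ∑ f : Fin m → Fin n, (∏ i, B i (f i)) * (B.submatrix id f).det =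
      ∑ f : Fin m → Fin n with univ.image f ∈ powersetCard m univ,
        (∏ i, B i (f i)) * (B.submatrix id f).det := by
    refine (sum_subset (filter_subset _ _) fun f _ hf => ?_).symm
    have : ¬ Function.Injective f := by
      intro hi
      apply hf
      simp [mem_powersetCard, card_image_of_injective _ hi]
    rw [Function.Injective] at this
    push Not at this
    obtain ⟨i, j, hij, hne⟩ := this
    rw [Matrix.det_zero_of_column_eq hne (by intro k; simp [hij]), mul_zero]
  have h3 := sum_fiberwise_of_maps_to
    (s := univ.filter fun f : Fin m → Fin n => univ.image f ∈ powersetCard m univ)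
    (t := powersetCard m (univ : Finset (Fin n))) (g := fun f => univ.image f)
    (fun f hf => (mem_filter.1 hf).2) (fun f => (∏ i, B i (f i)) * (B.submatrix id f).det)
  rw [h1, h2, ← h3, ← sum_attach]
  refine sum_congr rfl fun C _ => ?_
  set e : Fin m → Fin n :=
    fun j => (C.1.orderIsoOfFin (Finset.mem_powersetCard.mp C.2).2 j : Fin n) with he
  have hinj : Function.Injective e := fun a b h => by
    simpa [he] using h
  have him : univ.image e = C.1 := by
    have := image_orderEmbOfFin_univ C.1 (Finset.mem_powersetCard.mp C.2).2
    simpa [he] using this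
  have hdet : (B.submatrix id e).det ^ 2 = ∑ σ : Equiv.Perm (Fin m),
      (∏ i, B i (e (σ i))) * (B.submatrix id (e ∘ σ)).det := by
    have hp : ∀ σ : Equiv.Perm (Fin m), (B.submatrix id (e ∘ σ)).det =
        (Equiv.Perm.sign σ : ℤ) * (B.submatrix id e).det := fun σ => by
      rw [← Matrix.det_permute']
      rfl
    simp only [hp]
    rw [sq]
    nth_rewrite 1 [← Matrix.det_transpose]
    rw [Matrix.det_apply', sum_mul]
    refine sum_congr rfl fun σ _ => ?_
    simp only [Matrix.transpose_apply, Matrix.submatrix_apply, id]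
    ring
  rw [hdet]
  symm
  refine sum_bij (fun σ _ => e ∘ σ) ?_ ?_ ?_ ?_
  · intro σ _
    have : univ.image (e ∘ σ) = C.1 := by
      rw [← image_image, image_univ_equiv, him]
    simp only [mem_filter, mem_univ, true_and, this, and_true]
    exact C.2
  · intro σ _ τ _ h
    ext i
    have := hinj (congrFun h i)
    rw [this]
  · intro f hf
    have hf2 : univ.image f = C.1 := (mem_filter.1 hf).2
    have hcard : (univ.image f).card = m := by rw [hf2]; exact (mem_powersetCard.mp C.2).2
    have hfi : Function.Injective f := by
      have h7 : Set.InjOn f ((univ : Finset (Fin m)) : Set (Fin m)) :=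
        card_image_iff.1 (by simpa using hcard)
      exact fun a b h => h7 (by simp) (by simp) h
    have hex : ∀ i, ∃ j, e j = f i := by
      intro i
      have : f i ∈ univ.image e := by rw [him, ← hf2]; exact mem_image_of_mem _ (mem_univ _)
      simpa using this
    choose g hg using hex
    have hgi : Function.Injective g := fun a b h => hfi (by rw [← hg, ← hg, h])
    exact ⟨Equiv.ofBijective g (Finite.injective_iff_bijective.1 hgi), mem_univ _, by
      funext i; simp [hg]⟩
  · intro σ _
    rfl

theorem aux_row {n m : ℕ} (A : Matrix (Fin n) (Fin n) ℝ) (hA : IsPM1 A) (hn : 0 < n)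
    (r : Fin m → Fin n) :
    ((A.submatrix r id) * (A.submatrix r id).transpose).det ≤ (n : ℝ) ^ m ∧
    (((A.submatrix r id) * (A.submatrix r id).transpose).det = (n : ℝ) ^ m →
      (A.submatrix r id) * (A.submatrix r id).transpose = (n : ℝ) • 1) := by
  have hG := Matrix.posSemidef_self_mul_conjTranspose (A.submatrix r id)
  rw [Matrix.conjTranspose_eq_transpose_of_trivial] at hG
  have := aux_psd _ hG n (by exact_mod_cast hn) (by
    intro i
    have : ∀ j, A (r i) j * A (r i) j = 1 := fun j => by
      rcases hA (r i) j with h | h <;> simp [h]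
    simp [Matrix.mul_apply, this])
  simpa using this

/-- The mean of `det(M)^2` over all `m × m` submatrices of a `{±1}`-matrix `A` of
order `n ≥ m > 1` is at most `n^m / C(n,m)`, with equality iff `A` is Hadamard. -/
theorem avgMinorSq_le {n m : ℕ} (A : Matrix (Fin n) (Fin n) ℝ) (hA : IsPM1 A)
    (hm : 1 < m) (hmn : m ≤ n) :
    avgMinorSq A m ≤ (n : ℝ) ^ m / (n.choose m : ℝ) ∧
      (avgMinorSq A m = (n : ℝ) ^ m / (n.choose m : ℝ) ↔ IsHadamardMatrix A) := by
  classical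
  have hn : 0 < n := by omega
  have hK : (0 : ℝ) < n.choose m := by exact_mod_cast Nat.choose_pos hmn
  let r : ∀ R : {x // x ∈ Finset.powersetCard m (Finset.univ : Finset (Fin n))}, Fin m → Fin n :=
    fun R i => (R.1.orderIsoOfFin (Finset.mem_powersetCard.mp R.2).2 i : Fin n)
  have hrinj : ∀ R, Function.Injective (r R) := fun R a b h => by simpa [r] using h
  have hrim : ∀ R, Finset.univ.image (r R) = R.1 := fun R => by
    have := Finset.image_orderEmbOfFin_univ R.1 (Finset.mem_powersetCard.mp R.2).2
    simpa [r] using this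
  let D := fun R => ((A.submatrix (r R) id) * (A.submatrix (r R) id).transpose).det
  have havg : avgMinorSq A m =
      (∑ R ∈ (Finset.powersetCard m (Finset.univ : Finset (Fin n))).attach, D R)
        / (n.choose m : ℝ) ^ 2 := by
    unfold avgMinorSq
    congr 1
    refine Finset.sum_congr rfl fun R _ => ?_
    simp only [D]
    rw [aux_cb]
    rfl
  have hconst : ∑ R ∈ (Finset.powersetCard m (Finset.univ : Finset (Fin n))).attach, (n : ℝ) ^ m
      = n.choose m * (n : ℝ) ^ m := by
    simp
  have hrhs : (n : ℝ) ^ m / (n.choose m : ℝ) = (n.choose m * (n : ℝ) ^ m) / (n.choose m : ℝ) ^ 2 := by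
    field_simp
  have hDle : ∀ R ∈ (Finset.powersetCard m (Finset.univ : Finset (Fin n))).attach,
      D R ≤ (n : ℝ) ^ m := fun R _ => (aux_row A hA hn (r R)).1
  rw [havg, hrhs, ← hconst]
  refine ⟨div_le_div_of_nonneg_right (Finset.sum_le_sum hDle) (by positivity), ?_⟩
  rw [div_left_inj' (by positivity), Finset.sum_eq_sum_iff_of_le hDle]
  constructor
  · intro h
    refine ⟨hA, ?_⟩
    ext i j
    by_cases hij : i = j
    · subst hij
      have : ∀ k, A i k * A i k = 1 := fun k => by
        rcases hA i k with h | h <;> simp [h]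
      simp [Matrix.mul_apply, this]
    · obtain ⟨R, hR1, hR2⟩ := Finset.exists_superset_card_eq (s := {i, j}) (n := m)
        (by rw [Finset.card_pair hij]; omega) (by simpa using hmn)
      let R' : {x // x ∈ Finset.powersetCard m (Finset.univ : Finset (Fin n))} :=
        ⟨R, by simp [Finset.mem_powersetCard, hR2]⟩
      have hi : i ∈ Finset.univ.image (r R') := by rw [hrim]; exact hR1 (by simp)
      have hj : j ∈ Finset.univ.image (r R') := by rw [hrim]; exact hR1 (by simp)
      simp only [Finset.mem_image, Finset.mem_univ, true_and] at hi hj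
      obtain ⟨a, ha⟩ := hi
      obtain ⟨b, hb⟩ := hj
      have hab : a ≠ b := by rintro rfl; exact hij (ha.symm.trans hb)
      have h5 := (aux_row A hA hn (r R')).2 (h R' (Finset.mem_attach _ _))
      have h6 := congrFun (congrFun h5 a) b
      simpa [Matrix.mul_apply, ha, hb, hab, hij] using h6
  · rintro ⟨_, hH⟩ R _
    have : (A.submatrix (r R) id) * (A.submatrix (r R) id).transpose = (n : ℝ) • 1 := by
      ext a b
      have h6 := congrFun (congrFun hH (r R a)) (r R b)
      simpa [Matrix.mul_apply, Matrix.one_apply, (hrinj R).eq_iff] using h6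
    simp only [D]
    rw [this]
    simp
end

section
/- Let H be a Hadamard matrix of order n and let m be an integer with 1 < m ≤ n. Then the mean value E(det(M)²) of det(M)², taken over all m×m submatrices M of H, satisfies E(det(M)²) > m!. -/
theorem aux_sum_fun {m n : ℕ} (B : Matrix (Fin m) (Fin n) ℝ)
    (hB : B * B.transpose = (n : ℝ) • (1 : Matrix (Fin m) (Fin m) ℝ)) :
    ∑ f : Fin m → Fin n, (B.submatrix id f).det ^ 2 = (m.factorial : ℝ) * (n : ℝ) ^ m := by
  have hent : ∀ i j, ∑ k, B i k * B j k = if i = j then (n : ℝ) else 0 := by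
    intro i j
    have := congrFun (congrFun hB i) j
    simpa [Matrix.mul_apply, Matrix.one_apply] using this
  have h1 : ∀ f : Fin m → Fin n, (B.submatrix id f).det ^ 2 =
      ∑ σ : Equiv.Perm (Fin m), ∑ τ : Equiv.Perm (Fin m),
        (((Equiv.Perm.sign σ : ℤ) : ℝ) * ((Equiv.Perm.sign τ : ℤ) : ℝ)) *
          ∏ i, (B (σ i) (f i) * B (τ i) (f i)) := by
    intro f
    rw [sq, Matrix.det_apply', Finset.sum_mul_sum]
    refine Finset.sum_congr rfl fun σ _ => Finset.sum_congr rfl fun τ _ => ?_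
    rw [Finset.prod_mul_distrib]
    simp only [Matrix.submatrix_apply, id]
    ring
  simp_rw [h1]
  rw [Finset.sum_comm]
  have h2 : ∀ σ : Equiv.Perm (Fin m), ∑ f : Fin m → Fin n, ∑ τ : Equiv.Perm (Fin m),
        (((Equiv.Perm.sign σ : ℤ) : ℝ) * ((Equiv.Perm.sign τ : ℤ) : ℝ)) *
          ∏ i, (B (σ i) (f i) * B (τ i) (f i)) = (n : ℝ) ^ m := by
    intro σ
    rw [Finset.sum_comm]
    simp_rw [← Finset.mul_sum]
    have h3 : ∀ τ : Equiv.Perm (Fin m),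
        ∑ f : Fin m → Fin n, ∏ i, (B (σ i) (f i) * B (τ i) (f i)) =
          ∏ i, (if σ i = τ i then (n : ℝ) else 0) := by
      intro τ
      simp_rw [← hent]
      exact (Fintype.prod_sum (fun i k => B (σ i) k * B (τ i) k)).symm
    simp_rw [h3]
    rw [Finset.sum_eq_single σ]
    · have : (((Equiv.Perm.sign σ : ℤ) : ℝ) * ((Equiv.Perm.sign σ : ℤ) : ℝ)) = 1 := by
        rcases Int.units_eq_one_or (Equiv.Perm.sign σ) with h | h <;> simp [h]
      rw [this]; simp
    · intro τ _ hne
      have : ∃ i, σ i ≠ τ i := by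
        by_contra! h
        exact hne (Equiv.ext fun i => (h i).symm)
      obtain ⟨i, hi⟩ := this
      rw [Finset.prod_eq_zero (Finset.mem_univ i) (if_neg hi), mul_zero]
    · simp
  simp_rw [h2]
  simp [Fintype.card_perm]

theorem aux_le {m n : ℕ} (B : Matrix (Fin m) (Fin n) ℝ) :
    ∑ f : Fin m → Fin n, (B.submatrix id f).det ^ 2 ≤ (m.factorial : ℝ) *
      ∑ C ∈ (Finset.powersetCard m (Finset.univ : Finset (Fin n))).attach,
      (B.submatrix id
        (fun j => (C.1.orderIsoOfFin (Finset.mem_powersetCard.mp C.2).2 j : Fin n))).det ^ 2 := by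
  classical
  let P := (Finset.powersetCard m (Finset.univ : Finset (Fin n)))
  let e : P → Fin m → Fin n :=
    fun C j => (C.1.orderIsoOfFin (Finset.mem_powersetCard.mp C.2).2 j : Fin n)
  let F : P × Equiv.Perm (Fin m) → (Fin m → Fin n) := fun p => e p.1 ∘ p.2
  let g : (Fin m → Fin n) → ℝ := fun f => (B.submatrix id f).det ^ 2
  have hg0 : ∀ f, 0 ≤ g f := fun f => sq_nonneg _
  have hF : ∀ p, g (F p) = g (e p.1) := by
    rintro ⟨C, σ⟩
    have : B.submatrix id (e C ∘ σ) = (B.submatrix id (e C)).submatrix id σ := rfl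
    simp only [g, F]
    rw [this, Matrix.det_permute', mul_pow]
    rcases Int.units_eq_one_or (Equiv.Perm.sign σ) with h | h <;> simp [h]
  have hsurj : ∀ f : Fin m → Fin n, Function.Injective f → ∃ p, F p = f := by
    intro f hf
    have hC : Finset.univ.image f ∈ P := by
      simp [P, Finset.mem_powersetCard, Finset.card_image_of_injective _ hf]
    let o := (Finset.univ.image f).orderIsoOfFin (Finset.mem_powersetCard.mp hC).2
    let s : Fin m → Fin m := fun i => o.symm ⟨f i, by simp⟩
    have hs : Function.Injective s := by
      intro a b hab
      have := o.symm.injective hab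
      exact hf (congrArg Subtype.val this)
    refine ⟨(⟨_, hC⟩, Equiv.ofBijective s (Finite.injective_iff_bijective.mp hs)), ?_⟩
    funext i
    change ((o (o.symm ⟨f i, by simp⟩) : _) : Fin n) = f i
    rw [OrderIso.apply_symm_apply]
  have key : ∑ f, g f ≤ ∑ p, g (F p) := by
    rw [← Finset.sum_fiberwise Finset.univ F]
    refine Finset.sum_le_sum fun f _ => ?_
    by_cases hf : Function.Injective f
    · obtain ⟨p, rfl⟩ := hsurj f hf
      exact Finset.single_le_sum (f := fun p => g (F p)) (fun _ _ => hg0 _) (by simp)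
    · have : g f = 0 := by
        simp only [Function.Injective, not_forall] at hf
        obtain ⟨a, b, hab, hne⟩ := hf
        simp only [g]
        rw [Matrix.det_zero_of_column_eq hne (by intro k; simp [hab])]
        simp
      rw [this]
      exact Finset.sum_nonneg fun _ _ => hg0 _
  refine key.trans (le_of_eq ?_)
  simp_rw [hF]
  rw [Fintype.sum_prod_type]
  simp only [Finset.sum_const, Finset.card_univ, Fintype.card_perm, Fintype.card_fin,
    nsmul_eq_mul, ← Finset.mul_sum]
  rfl

theorem aux_desc {n m : ℕ} (hm : 1 < m) (hmn : m ≤ n) : n.descFactorial m < n ^ m :=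
  Nat.descFactorial_lt_pow (by omega) hm

/-- The mean of `det(M)^2` over the `m × m` submatrices of a Hadamard matrix of
order `n ≥ m > 1` exceeds `m!`. -/
theorem factorial_lt_avgMinorSq {n m : ℕ}
    (H : Matrix (Fin n) (Fin n) ℝ) (hH : IsHadamardMatrix H)
    (hm : 1 < m) (hmn : m ≤ n) :
    (m.factorial : ℝ) < avgMinorSq H m := by
  have hdf : m.factorial * n.choose m < n ^ m := by
    rw [← Nat.descFactorial_eq_factorial_mul_choose]; exact aux_desc hm hmn
  have hdf' : (m.factorial : ℝ) * (n.choose m : ℝ) < (n : ℝ) ^ m := by exact_mod_cast hdf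
  have hc : (0 : ℝ) < n.choose m := by exact_mod_cast Nat.choose_pos hmn
  have hfac : (0 : ℝ) < m.factorial := by exact_mod_cast m.factorial_pos
  unfold avgMinorSq
  rw [lt_div_iff₀ (by positivity)]
  have hrow : ∀ R ∈ (Finset.powersetCard m (Finset.univ : Finset (Fin n))).attach,
      (n : ℝ) ^ m ≤
    ∑ C ∈ (Finset.powersetCard m (Finset.univ : Finset (Fin n))).attach,
      (H.submatrix
        (fun i => (R.1.orderIsoOfFin (Finset.mem_powersetCard.mp R.2).2 i : Fin n))
        (fun j => (C.1.orderIsoOfFin (Finset.mem_powersetCard.mp C.2).2 j : Fin n))).det ^ 2 := by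
    intro R _
    let r : Fin m → Fin n :=
      fun i => (R.1.orderIsoOfFin (Finset.mem_powersetCard.mp R.2).2 i : Fin n)
    have hr : Function.Injective r := fun a b h =>
      (R.1.orderIsoOfFin (Finset.mem_powersetCard.mp R.2).2).injective (Subtype.ext h)
    have hB : (H.submatrix r id) * (H.submatrix r id).transpose =
        (n : ℝ) • (1 : Matrix (Fin m) (Fin m) ℝ) := by
      ext i j
      have := congrFun (congrFun hH.2 (r i)) (r j)
      simpa [Matrix.mul_apply, Matrix.one_apply, hr.eq_iff] using this
    have h := aux_le (H.submatrix r id)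
    rw [aux_sum_fun _ hB] at h
    exact le_of_mul_le_mul_left h hfac
  have hsum := Finset.card_nsmul_le_sum _ _ _ hrow
  rw [Finset.card_attach, Finset.card_powersetCard, Finset.card_univ, Fintype.card_fin,
    nsmul_eq_mul] at hsum
  refine lt_of_lt_of_le ?_ hsum
  nlinarith
end

section
/- (Turán) For every positive integer m, the sum of det(A)² over all 2^{m²} matrices A of order m with entries in {+1, −1} equals 2^{m²} · m!. Equivalently, the expected value of det(A)² for a uniformly random {±1}-matrix of order m is m!. -/
lemma turan_row (m : ℕ) (a b : Fin m) :
    ∑ r : Fin m → Bool, (if r a then (1 : ℝ) else -1) * (if r b then (1 : ℝ) else -1)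
      = if a = b then 2 ^ m else 0 := by
  split_ifs with h
  · subst h
    have : ∀ r : Fin m → Bool,
        (if r a then (1 : ℝ) else -1) * (if r a then (1 : ℝ) else -1) = 1 := by
      intro r; split_ifs <;> norm_num
    simp [this]
  · refine Finset.sum_involution (fun r _ => Function.update r a (!r a)) ?_ ?_ ?_ ?_
    · intro r _
      have hb : b ≠ a := fun e => h e.symm
      simp only [Function.update_self, Function.update_of_ne hb]
      cases r a <;> cases r b <;> simp
    · intro r _ _ e
      have := congrFun e a
      simp at this
    · intro r _; simp
    · intro r _; simp

/-- (Turán) The sum of `det(A)^2` over all `2^(m²)` matrices of order `m` with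
entries in `{+1, -1}` equals `2^(m²) · m!`; equivalently, the expected value of
`det(A)^2` for a uniformly random `{±1}`-matrix of order `m` is `m!`.
The `{±1}`-matrices of order `m` are enumerated by the functions
`Fin m → Fin m → Bool`. -/
theorem turan_sum_det_sq (m : ℕ) (hm : 0 < m) :
    ∑ f : Fin m → Fin m → Bool,
        (Matrix.of fun i j => if f i j then (1 : ℝ) else -1).det ^ 2 =
      2 ^ (m ^ 2) * (m.factorial : ℝ) := by
  have key : ∀ σ τ : Equiv.Perm (Fin m),
      ∑ f : Fin m → Fin m → Bool, ∏ i, ((if f i (σ i) then (1 : ℝ) else -1) *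
        (if f i (τ i) then (1 : ℝ) else -1)) = if σ = τ then 2 ^ (m ^ 2) else 0 := by
    intro σ τ
    have h := Finset.prod_univ_sum (fun _ : Fin m => (Finset.univ : Finset (Fin m → Bool)))
      (fun i r => (if r (σ i) then (1 : ℝ) else -1) * (if r (τ i) then (1 : ℝ) else -1))
    rw [Fintype.piFinset_univ] at h
    rw [← h]
    simp only [turan_row]
    split_ifs with e
    · subst e
      simp [← pow_mul, sq]
    · obtain ⟨i, hi⟩ : ∃ i, σ i ≠ τ i := by
        by_contra! hc
        exact e (Equiv.ext hc)
      exact Finset.prod_eq_zero (Finset.mem_univ i) (if_neg hi)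
  have expand : ∀ f : Fin m → Fin m → Bool,
      (Matrix.of fun i j => if f i j then (1 : ℝ) else -1).det ^ 2 =
      ∑ σ : Equiv.Perm (Fin m), ∑ τ : Equiv.Perm (Fin m),
        (((Equiv.Perm.sign σ : ℤ) : ℝ) * ((Equiv.Perm.sign τ : ℤ) : ℝ)) *
        ∏ i, ((if f i (σ i) then (1 : ℝ) else -1) *
        (if f i (τ i) then (1 : ℝ) else -1)) := by
    intro f
    rw [← Matrix.det_transpose, Matrix.det_apply', sq, Finset.sum_mul_sum]
    refine Finset.sum_congr rfl fun σ _ => Finset.sum_congr rfl fun τ _ => ?_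
    rw [Finset.prod_mul_distrib]
    simp only [Matrix.transpose_apply, Matrix.of_apply]
    ring
  simp only [expand]
  rw [Finset.sum_comm]
  have : ∀ σ : Equiv.Perm (Fin m), ∑ f : Fin m → Fin m → Bool, ∑ τ : Equiv.Perm (Fin m),
        (((Equiv.Perm.sign σ : ℤ) : ℝ) * ((Equiv.Perm.sign τ : ℤ) : ℝ)) *
        ∏ i, ((if f i (σ i) then (1 : ℝ) else -1) *
        (if f i (τ i) then (1 : ℝ) else -1)) = 2 ^ (m ^ 2) := by
    intro σ
    rw [Finset.sum_comm]
    simp only [← Finset.mul_sum, key]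
    have hs : ((Equiv.Perm.sign σ : ℤ) : ℝ) * ((Equiv.Perm.sign σ : ℤ) : ℝ) = 1 := by
      rcases Int.units_eq_one_or (Equiv.Perm.sign σ) with h | h <;> simp [h]
    simp [hs]
  simp only [this]
  simp [Fintype.card_perm, mul_comm]
end

section
/- Let H be a Hadamard matrix of order n. Then the number Z(2,H) of vanishing minors of order 2 of H equals n²(n−1)(n−2)/8. -/
/-- `Z m A` is the number of pairs `(R, C)` of `m`-element subsets of the row and
column indices of `A` such that the `m × m` submatrix of `A` on rows `R` and
columns `C` has vanishing determinant. -/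
noncomputable def Z {n : ℕ} (m : ℕ) (A : Matrix (Fin n) (Fin n) ℝ) : ℕ :=
  Nat.card {p : Finset (Fin n) × Finset (Fin n) //
    ∃ (h₁ : p.1.card = m) (h₂ : p.2.card = m),
      (A.submatrix (fun i => (p.1.orderIsoOfFin h₁ i : Fin n))
        (fun j => (p.2.orderIsoOfFin h₂ j : Fin n))).det = 0}

lemma aux_sym {n : ℕ} (f : Fin n → Fin n → ℝ) (hf : ∀ i k, f i k = f k i) :
    2 * ∑ i, ∑ k, (if i < k then f i k else 0) = ∑ i, ∑ k, f i k - ∑ i, f i i := by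
  have h1 : ∑ i, ∑ k, (if i < k then f i k else 0) = ∑ i, ∑ k, (if k < i then f i k else 0) := by
    rw [Finset.sum_comm]
    refine Finset.sum_congr rfl fun i _ => Finset.sum_congr rfl fun k _ => ?_
    rw [hf]
  have h2 : ∑ i, f i i = ∑ i, ∑ k, (if i = k then f i k else 0) := by simp
  rw [two_mul]
  nth_rewrite 2 [h1]
  rw [h2, ← Finset.sum_add_distrib, ← Finset.sum_sub_distrib]
  refine Finset.sum_congr rfl fun i _ => ?_
  rw [← Finset.sum_add_distrib, ← Finset.sum_sub_distrib]
  refine Finset.sum_congr rfl fun k _ => ?_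
  rcases lt_trichotomy i k with h | h | h
  · simp [h, h.not_gt, h.ne]
  · simp [h]
  · simp [h, h.not_gt, h.ne']

lemma aux_pair {n : ℕ} {s : Finset (Fin n)} (h : s.card = 2) :
    (s.orderIsoOfFin h 0 : Fin n) < (s.orderIsoOfFin h 1 : Fin n) ∧
      s = {(s.orderIsoOfFin h 0 : Fin n), (s.orderIsoOfFin h 1 : Fin n)} := by
  have hlt : (s.orderIsoOfFin h 0 : Fin n) < (s.orderIsoOfFin h 1 : Fin n) := by
    have : s.orderIsoOfFin h 0 < s.orderIsoOfFin h 1 := by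
      rw [OrderIso.lt_iff_lt]; decide
    exact this
  refine ⟨hlt, ?_⟩
  symm
  apply Finset.eq_of_subset_of_card_le
  · intro x hx
    simp only [Finset.mem_insert, Finset.mem_singleton] at hx
    rcases hx with rfl | rfl
    · exact (s.orderIsoOfFin h 0).2
    · exact (s.orderIsoOfFin h 1).2
  · rw [h, Finset.card_pair hlt.ne]

lemma aux_inj {n : ℕ} {a b c d : Fin n} (h1 : a < b) (h2 : c < d)
    (h : ({a, b} : Finset (Fin n)) = {c, d}) : a = c ∧ b = d := by
  have ha : a ∈ ({c, d} : Finset (Fin n)) := h ▸ by simp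
  have hb : b ∈ ({c, d} : Finset (Fin n)) := h ▸ by simp
  have hc : c ∈ ({a, b} : Finset (Fin n)) := h ▸ by simp
  simp only [Finset.mem_insert, Finset.mem_singleton] at ha hb hc
  grind

lemma aux_Z {n : ℕ} (H : Matrix (Fin n) (Fin n) ℝ) :
    (Z 2 H : ℝ) = ∑ i, ∑ k, if i < k then
      (∑ j, ∑ l, if j < l then (if H i j * H k l = H i l * H k j then (1 : ℝ) else 0) else 0)
      else 0 := by
  classical
  let S : Finset ((Fin n × Fin n) × (Fin n × Fin n)) := Finset.univ.filter fun q =>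
    q.1.1 < q.1.2 ∧ q.2.1 < q.2.2 ∧ H q.1.1 q.2.1 * H q.1.2 q.2.2 = H q.1.1 q.2.2 * H q.1.2 q.2.1
  have hZ : Z 2 H = S.card := by
    let f : ((Fin n × Fin n) × (Fin n × Fin n)) → Finset (Fin n) × Finset (Fin n) :=
      fun q => ({q.1.1, q.1.2}, {q.2.1, q.2.2})
    have hinj : Set.InjOn f S := by
      rintro ⟨⟨a, b⟩, c, d⟩ h ⟨⟨a', b'⟩, c', d'⟩ h' e
      simp only [S, Finset.coe_filter, Finset.mem_univ, true_and, Set.mem_ofPred_eq] at h h'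
      simp only [f, Prod.mk.injEq] at e
      obtain ⟨rfl, rfl⟩ := aux_inj h.1 h'.1 e.1
      obtain ⟨rfl, rfl⟩ := aux_inj h.2.1 h'.2.1 e.2
      rfl
    rw [← Finset.card_image_of_injOn hinj, Z, ← Nat.card_eq_finsetCard]
    apply Nat.card_congr
    refine Equiv.subtypeEquivRight ?_
    rintro ⟨R, C⟩
    simp only [Finset.mem_image, S, Finset.mem_filter, Finset.mem_univ, true_and, f, Prod.mk.injEq]
    constructor
    · rintro ⟨h1, h2, hdet⟩
      rw [Matrix.det_fin_two] at hdet
      simp only [Matrix.submatrix_apply] at hdet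
      exact ⟨((_, _), (_, _)), ⟨(aux_pair h1).1, (aux_pair h2).1, sub_eq_zero.1 hdet⟩,
        (aux_pair h1).2.symm, (aux_pair h2).2.symm⟩
    · rintro ⟨⟨⟨a, b⟩, c, d⟩, ⟨hab, hcd, hd⟩, e1, e2⟩
      have h1 : R.card = 2 := by rw [← e1]; exact Finset.card_pair hab.ne
      have h2 : C.card = 2 := by rw [← e2]; exact Finset.card_pair hcd.ne
      refine ⟨h1, h2, ?_⟩
      rw [Matrix.det_fin_two]
      simp only [Matrix.submatrix_apply]
      obtain ⟨ea, eb⟩ := aux_inj hab (aux_pair h1).1 (e1.trans (aux_pair h1).2)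
      obtain ⟨ec, ed⟩ := aux_inj hcd (aux_pair h2).1 (e2.trans (aux_pair h2).2)
      rw [← ea, ← eb, ← ec, ← ed]
      exact sub_eq_zero.2 hd
  have hS : (S.card : ℝ) = ∑ i, ∑ k, ∑ j, ∑ l, if i < k ∧ j < l ∧
      H i j * H k l = H i l * H k j then (1 : ℝ) else 0 := by
    simp only [S, Finset.card_filter, Nat.cast_sum, Fintype.sum_prod_type]
    simp
  rw [hZ, hS]
  refine Finset.sum_congr rfl fun i _ => Finset.sum_congr rfl fun k _ => ?_
  by_cases h : i < k
  · simp only [h, true_and, if_true]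
    refine Finset.sum_congr rfl fun j _ => Finset.sum_congr rfl fun l _ => ?_
    by_cases h' : j < l <;> simp [h']
  · simp [h]

/-- The number of vanishing `2 × 2` minors of a Hadamard matrix of order `n` is
`n²(n-1)(n-2)/8`. -/
theorem count_vanishing_order_two_minors {n : ℕ}
    (H : Matrix (Fin n) (Fin n) ℝ) (hH : IsHadamardMatrix H) :
    8 * Z 2 H = n ^ 2 * (n - 1) * (n - 2) := by
  obtain ⟨hpm, hmul⟩ := hH
  have hin : ∀ i k, i < k →
      (∑ j, ∑ l, if j < l then (if H i j * H k l = H i l * H k j then (1 : ℝ) else 0) else 0)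
        = (n : ℝ) * (n - 2) / 4 := by
    intro i k hik
    have horth : ∑ j, H i j * H k j = 0 := by
      have := congrFun (congrFun hmul i) k
      simpa [Matrix.mul_apply, Matrix.one_apply, hik.ne] using this
    have hind : ∀ j l, (if H i j * H k l = H i l * H k j then (1 : ℝ) else 0)
        = 1 / 2 + (H i j * H k j) * (H i l * H k l) / 2 := by
      intro j l
      rcases hpm i j with a | a <;> rcases hpm i l with b | b <;> rcases hpm k j with c | c <;>
        rcases hpm k l with d | d <;> rw [a, b, c, d] <;> norm_num
    have h := aux_sym (fun j l => 1 / 2 + (H i j * H k j) * (H i l * H k l) / 2)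
      (fun j l => by ring)
    simp only [hind]
    have hd : ∀ j, (1 / 2 + (H i j * H k j) * (H i j * H k j) / 2 : ℝ) = 1 := by
      intro j
      rcases hpm i j with a | a <;> rcases hpm k j with c | c <;> rw [a, c] <;> norm_num
    have hs : ∑ j, ∑ l, (1 / 2 + (H i j * H k j) * (H i l * H k l) / 2 : ℝ) = n * n / 2 := by
      have : ∀ j, ∑ l, (1 / 2 + (H i j * H k j) * (H i l * H k l) / 2 : ℝ) = n / 2 := by
        intro j
        rw [Finset.sum_add_distrib]
        have h0 : ∑ l, (H i j * H k j) * (H i l * H k l) / 2 = 0 := by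
          rw [← Finset.sum_div, ← Finset.mul_sum, horth]; simp
        rw [h0]
        simp; ring
      simp only [this]
      simp; ring
    simp only [hd] at h
    rw [hs] at h
    simp at h
    simp
    linarith
  have hZ := aux_Z H
  have h2 : (Z 2 H : ℝ) = ∑ i : Fin n, ∑ k : Fin n,
      if i < k then (n : ℝ) * (n - 2) / 4 else 0 := by
    rw [hZ]
    refine Finset.sum_congr rfl fun i _ => Finset.sum_congr rfl fun k _ => ?_
    split_ifs with h
    · exact hin i k h
    · rfl
  have h3 := aux_sym (fun _ _ : Fin n => (n : ℝ) * (n - 2) / 4) (fun _ _ => rfl)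
  rw [← h2] at h3
  simp at h3
  have h4 : (8 * Z 2 H : ℝ) = n ^ 2 * (n - 1) * (n - 2) := by
    linear_combination 4 * h3
  generalize Z 2 H = z at h4
  clear * - h4
  rcases n with _ | _ | m
  · simpa using h4
  · simpa using h4
  · have h5 : ((8 * z : ℕ) : ℝ) = (((m + 2) ^ 2 * (m + 1) * m : ℕ) : ℝ) := by
      push_cast at h4 ⊢
      rw [h4]; ring
    exact_mod_cast h5
end

section
/- For every positive integer n, ∑_{k=1}^{n} C(n,k) · (∑_{j=1}^{k} C(n,j)·j) = 4^{n−1} · n, where C(n,k) denotes the binomial coefficient. -/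
theorem aux_inner (m k : ℕ) :
    ∑ j ∈ Finset.Icc 1 k, (m + 1).choose j * j
      = (m + 1) * ∑ i ∈ Finset.range k, m.choose i := by
  induction k with
  | zero => simp
  | succ k ih =>
    rw [Finset.sum_Icc_succ_top (by omega), ih, Finset.sum_range_succ, mul_add (m + 1),
      Nat.add_one_mul_choose_eq]

theorem aux_tele (m K : ℕ) :
    ∑ k ∈ Finset.Icc 1 K, (m + 1).choose k * ∑ i ∈ Finset.range k, m.choose i
      = (∑ i ∈ Finset.range (K + 1), m.choose i) * ∑ i ∈ Finset.range K, m.choose i := by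
  induction K with
  | zero => simp
  | succ K ih =>
    rw [Finset.sum_Icc_succ_top (by omega), ih, Finset.sum_range_succ _ (K + 1),
      Finset.sum_range_succ _ K, Nat.choose_succ_succ]
    ring

/-- Operation count for Algorithm D:
`∑_{k=1}^n C(n,k) · (∑_{j=1}^k C(n,j)·j) = 4^{n-1} · n`. -/
theorem algorithm_D_operation_count (n : ℕ) (hn : 0 < n) :
    ∑ k ∈ Finset.Icc 1 n, n.choose k * ∑ j ∈ Finset.Icc 1 k, n.choose j * j =
      4 ^ (n - 1) * n := by
  obtain ⟨m, rfl⟩ : ∃ m, n = m + 1 := ⟨n - 1, by omega⟩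
  simp only [aux_inner, mul_left_comm _ (m + 1)]
  rw [← Finset.mul_sum, aux_tele, Finset.sum_range_succ _ (m + 1), Nat.sum_range_choose,
    Nat.choose_succ_self, Nat.add_sub_cancel, add_zero, ← mul_pow, mul_comm]
  norm_num
end
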